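/- For every e ∈ ℰ there exists λ₀ > 0 such that for every 0 < λ < λ₀ and every interval I ⊆ ℐ^e with the property that every z ∈ X with 𝒫(z) ∈ I is regular, the following holds with X^e = {z ∈ X : 𝒫(z) ∈ I}: for every l ∈ 𝕃^e and every z with z ∈ X^e and z + λl ∈ X^e, there is an integer j such that Φ(z + λl) = Φ(z) + λl + j·λ·𝐰₁, where 𝐰₁ = (2v₁+1, −(2v₁+1)). -/

import Mathlib

open Filter Topology

/-- The discretised rotation `F(x,y) = (⌊λx⌋ − y, x)` as a permutation of `ℤ²`. -/
noncomputable def Fe (lam : ℝ) : Equiv.Perm (ℤ × ℤ) where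
  toFun p := (⌊lam * p.1⌋ - p.2, p.1)
  invFun p := (p.2, ⌊lam * p.2⌋ - p.1)
  left_inv p := by simp
  right_inv p := by simp

/-- The point of `(λℤ)² ⊂ ℝ²` with lattice index `p ∈ ℤ²`. -/
noncomputable def pt (lam : ℝ) (p : ℤ × ℤ) : ℝ × ℝ := (lam * p.1, lam * p.2)

/-- The piecewise-affine function `P(x) = ⌊x⌋² + (2⌊x⌋+1)(x − ⌊x⌋)`. -/
noncomputable def Pfun (x : ℝ) : ℝ := (⌊x⌋ : ℝ)^2 + (2*(⌊x⌋ : ℝ)+1)*(x - ⌊x⌋)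

/-- The piecewise-affine Hamiltonian `𝒫(x,y) = P(x) + P(y)`. -/
noncomputable def ham (z : ℝ × ℝ) : ℝ := Pfun z.1 + Pfun z.2

/-- Euclidean distance from `z ∈ ℝ²` to the symmetry line `{(t,t)}`. -/
noncomputable def dline (z : ℝ × ℝ) : ℝ := |z.1 - z.2| / Real.sqrt 2

/-- The return domain `X`, described by lattice indices. -/
noncomputable def Xset (lam : ℝ) : Set (ℤ × ℤ) :=
  {p | 0 ≤ p.1 ∧ 0 ≤ p.2 ∧
    dline (pt lam p) ≤ dline (pt lam ((Fe lam ^ 4) p)) ∧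
    dline (pt lam p) < dline (pt lam ((Fe lam ^ (-4 : ℤ)) p))}

/-- The forward transit time `τ(z) = min{k ≥ 1 : F_λᵏ(z) ∈ X}`. -/
noncomputable def tauPlus (lam : ℝ) (p : ℤ × ℤ) : ℕ :=
  sInf {k : ℕ | 1 ≤ k ∧ (Fe lam ^ (k : ℤ)) p ∈ Xset lam}

/-- The first-return map `Φ(z) = F_λ^{τ(z)}(z)` (on lattice indices). -/
noncomputable def Phi (lam : ℝ) (p : ℤ × ℤ) : ℤ × ℤ := (Fe lam ^ (tauPlus lam p : ℤ)) p

/-- The round-off map `R(x,y) = (⌊x⌋, ⌊y⌋)`. -/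
noncomputable def Rmap (q : ℝ × ℝ) : ℤ × ℤ := (⌊q.1⌋, ⌊q.2⌋)

/-- `z = λ·p` is a transition point: `R(F_λ⁴(z)) ≠ R(z)`; these form the set `Λ`. -/
def IsTransition (lam : ℝ) (p : ℤ × ℤ) : Prop :=
  Rmap (pt lam ((Fe lam ^ 4) p)) ≠ Rmap (pt lam p)

/-- The set `Σ` of transition points within distance `λ(‖𝐰_{m,n}‖∞ + 2)` of some
lattice point `(m,n) ∈ ℤ²` (sup norm). -/
def SigSet (lam : ℝ) : Set (ℤ × ℤ) :=
  {p | IsTransition lam p ∧ ∃ m n : ℤ,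
    max |lam * p.1 - m| |lam * p.2 - n|
      ≤ lam * (((max |2*n+1| |2*m+1| : ℤ) : ℝ) + 2)}

/-- `e` is a sum of two integer squares. -/
def sumTwoSq (e : ℕ) : Prop := ∃ a b : ℤ, (e : ℤ) = a^2 + b^2

/-- The successor of `e` in the sequence `ℰ` of sums of two squares. -/
noncomputable def nextE (e : ℕ) : ℕ := sInf {f : ℕ | e < f ∧ sumTwoSq f}

/-- The critical interval `ℐ^e = (e, e⁺)`. -/
noncomputable def Ie (e : ℕ) : Set ℝ := Set.Ioo (e : ℝ) (nextE e : ℝ)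

/-- A point `z = λ·p ∈ X` with `𝒫(z) ∈ ℐ^e` is regular: neither `z` nor `Φ(z)`
is a transition point, the return orbit `𝒪_τ(z)` stays in the polygon class
(`𝒫 ∈ ℐ^e`), and `𝒪_τ(z)` avoids `Σ`. -/
noncomputable def RegularPt (lam : ℝ) (e : ℕ) (p : ℤ × ℤ) : Prop :=
  p ∈ Xset lam ∧ ham (pt lam p) ∈ Ie e ∧
  ¬ IsTransition lam p ∧ ¬ IsTransition lam (Phi lam p) ∧
  (∀ k : ℕ, k ≤ tauPlus lam p → ham (pt lam ((Fe lam ^ (k : ℤ)) p)) ∈ Ie e) ∧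
  (∀ k : ℕ, k ≤ tauPlus lam p → (Fe lam ^ (k : ℤ)) p ∉ SigSet lam)

/-- Position of the vertex with integer coordinate `c` in the first-octant
vertex ordering of the polygon class `e` (order of increasing `x`-coordinate). -/
def vidx (e c : ℕ) : ℕ :=
  if c ≤ Nat.sqrt (e / 2) then Nat.sqrt (e - c^2) - c else c - 1 - Nat.sqrt (e - c^2)

/-- The vertex list `V(e) = (v₁, …, v_k)`: the types `⌊√(e−c²)⌋` of the
first-octant vertices, listed in order of increasing `x`-coordinate. -/
def vertexList (e : ℕ) : List ℕ :=
  (((List.range (Nat.sqrt e + 1)).mergeSort (fun c c' => vidx e c ≤ vidx e c')).map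
    (fun c => Nat.sqrt (e - c^2)))

/-- The distinct vertex types `v_{ι(1)}, …, v_{ι(l)}` in order of occurrence. -/
def distinctTypes (e : ℕ) : List ℕ := (vertexList e).destutter (· ≠ ·)

/-- `q(e) = lcm((2v_{ι(1)}+1)², (2v_{ι(1)}+1)(2v_{ι(2)}+1), …,
(2v_{ι(l−1)}+1)(2v_{ι(l)}+1))`. -/
def qe (e : ℕ) : ℕ :=
  ((((distinctTypes e).zip (distinctTypes e).tail).map
      (fun p => (2*p.1+1) * (2*p.2+1))).foldr Nat.lcm
    ((2 * (distinctTypes e).headD 0 + 1)^2))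

/-- The generator `L = (q(e)/(2v₁+1))·(1,1)` of the lattice `𝕃^e`. -/
def Lvec (e : ℕ) : ℤ × ℤ :=
  ((qe e : ℤ) / (2 * (Nat.sqrt (e / 2) : ℤ) + 1),
   (qe e : ℤ) / (2 * (Nat.sqrt (e / 2) : ℤ) + 1))

/-- The vector `𝐰₁ = (2v₁+1, −(2v₁+1))`. -/
def w1vec (e : ℕ) : ℤ × ℤ :=
  (2 * (Nat.sqrt (e / 2) : ℤ) + 1, -(2 * (Nat.sqrt (e / 2) : ℤ) + 1))

/-- The second generator `(L − 𝐰₁)/2` of the lattice `𝕃^e`. -/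
def Mvec (e : ℕ) : ℤ × ℤ :=
  (((Lvec e).1 - (w1vec e).1) / 2, ((Lvec e).2 - (w1vec e).2) / 2)

/-- The lattice `𝕃^e ⊆ ℤ²` generated by `L` and `(L − 𝐰₁)/2`. -/
def latticeE (e : ℕ) : AddSubgroup (ℤ × ℤ) := AddSubgroup.closure {Lvec e, Mvec e}


/-! ### Number theory of the vertex list -/

lemma destutter'_head (a : ℕ) (l : List ℕ) :
    ∃ B, List.destutter' (· ≠ ·) a l = a :: B := by
  induction l generalizing a with
  | nil => exact ⟨[], rfl⟩
  | cons b l ih =>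
    by_cases h : a ≠ b
    · exact ⟨_, List.destutter'_cons_pos l h⟩
    · rw [List.destutter'_cons_neg l h]; exact ih a

lemma destutter'_mem (a : ℕ) (l : List ℕ) (x : ℕ) (hx : x ∈ a :: l) :
    x ∈ List.destutter' (· ≠ ·) a l := by
  induction l generalizing a with
  | nil => simpa using hx
  | cons b l ih =>
    by_cases h : a ≠ b
    · rw [List.destutter'_cons_pos l h]
      rcases List.mem_cons.1 hx with h1 | h1
      · simp [h1]
      · exact List.mem_cons_of_mem _ (ih b h1)
    · rw [List.destutter'_cons_neg l h]
      push Not at h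
      subst h
      apply ih
      simpa using hx

lemma destutter'_adj (a : ℕ) (l L1 L2 : List ℕ) (t t' : ℕ) (ht : t ≠ t')
    (h : a :: l = L1 ++ t :: t' :: L2) :
    ∃ A B, List.destutter' (· ≠ ·) a l = A ++ t :: t' :: B := by
  induction l generalizing a L1 with
  | nil =>
    have := congrArg List.length h
    simp at this
    omega
  | cons b l ih =>
    rcases L1 with _ | ⟨x, L1⟩
    · simp at h
      obtain ⟨rfl, rfl, rfl⟩ := h
      rw [List.destutter'_cons_pos l ht]
      obtain ⟨B, hB⟩ := destutter'_head b l
      exact ⟨[], B, by rw [hB]; rfl⟩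
    · simp at h
      obtain ⟨rfl, h⟩ := h
      by_cases hab : a ≠ b
      · rw [List.destutter'_cons_pos l hab]
        obtain ⟨A, B, hA⟩ := ih b L1 h
        exact ⟨a :: A, B, by rw [hA]; rfl⟩
      · rw [List.destutter'_cons_neg l hab]
        push Not at hab
        subst hab
        exact ih a L1 h

lemma sorted_adj {l : List ℕ} {f : ℕ → ℕ} (hs : l.Pairwise (fun a b => f a < f b)) {c c' : ℕ}
    (hc : c ∈ l) (hc' : c' ∈ l) (hf : f c' = f c + 1) :
    ∃ L1 L2, l = L1 ++ c :: c' :: L2 := by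
  obtain ⟨L1, R, rfl⟩ := List.append_of_mem hc
  rw [List.pairwise_append, List.pairwise_cons] at hs
  obtain ⟨_, ⟨h2, h2'⟩, h3⟩ := hs
  have hR : c' ∈ R := by
    rcases List.mem_append.1 hc' with h | h
    · have := h3 c' h c (by simp); omega
    · rcases List.mem_cons.1 h with h | h
      · subst h; omega
      · exact h
  rcases R with _ | ⟨d, R⟩
  · simp at hR
  · rcases List.mem_cons.1 hR with h | h
    · subst h; exact ⟨L1, R, rfl⟩
    · have h4 := (List.pairwise_cons.1 h2').1 c' h
      have h5 := h2 d (by simp)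
      omega

lemma sorted_head {l : List ℕ} {f : ℕ → ℕ} (hs : l.Pairwise (fun a b => f a < f b)) {c : ℕ}
    (hc : c ∈ l) (hf : f c = 0) : ∃ L, l = c :: L := by
  rcases l with _ | ⟨d, l⟩
  · simp at hc
  · rcases List.mem_cons.1 hc with h | h
    · subst h; exact ⟨l, rfl⟩
    · have := (List.pairwise_cons.1 hs).1 c h
      omega

lemma sqrt_eq_of (e c n : ℕ) (h1 : c ^ 2 + n ^ 2 ≤ e) (h2 : e < c ^ 2 + (n + 1) ^ 2) :
    Nat.sqrt (e - c ^ 2) = n := by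
  apply le_antisymm
  · rw [← Nat.lt_succ_iff, Nat.sqrt_lt']; simp only [Nat.succ_eq_add_one]; omega
  · rw [Nat.le_sqrt']; omega

lemma sqrt_spec (e c : ℕ) (hc : c ≤ Nat.sqrt e) :
    c ^ 2 + (Nat.sqrt (e - c ^ 2)) ^ 2 ≤ e ∧ e < c ^ 2 + (Nat.sqrt (e - c ^ 2) + 1) ^ 2 := by
  have h0 : c ^ 2 ≤ e := Nat.le_sqrt'.1 hc
  have h1 := Nat.sqrt_le' (e - c ^ 2)
  have h2 := Nat.lt_succ_sqrt' (e - c ^ 2)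
  simp only [Nat.succ_eq_add_one] at h2
  omega

lemma v1_spec (e : ℕ) : 2 * (Nat.sqrt (e / 2)) ^ 2 ≤ e ∧ e < 2 * (Nat.sqrt (e / 2) + 1) ^ 2 := by
  have h1 := Nat.sqrt_le' (e / 2)
  have h2 := Nat.lt_succ_sqrt' (e / 2)
  simp only [Nat.succ_eq_add_one] at h2
  omega

lemma le_v1_iff (e c : ℕ) : c ≤ Nat.sqrt (e / 2) ↔ 2 * c ^ 2 ≤ e := by
  rw [Nat.le_sqrt', Nat.le_div_iff_mul_le (by norm_num)]
  omega

lemma vidx_inj (e : ℕ) {c c' : ℕ} (hc : c ≤ Nat.sqrt e) (hc' : c' ≤ Nat.sqrt e) (hlt : c < c')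
    (h : vidx e c = vidx e c') : False := by
  obtain ⟨h1, h2⟩ := sqrt_spec e c hc
  obtain ⟨h3, h4⟩ := sqrt_spec e c' hc'
  unfold vidx at h
  generalize Nat.sqrt (e - c ^ 2) = m at *
  generalize Nat.sqrt (e - c' ^ 2) = n at *
  have k1 := le_v1_iff e c
  have k2 := le_v1_iff e c'
  have sq : ∀ a b : ℕ, a ≤ b → a ^ 2 ≤ b ^ 2 := fun a b hab => Nat.pow_le_pow_left hab 2
  have hcc := sq c c' hlt.le
  have hnm : n ≤ m := by
    by_contra hh
    have := sq (m + 1) n (by omega)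
    omega
  have low : ∀ x y : ℕ, 2 * x ^ 2 ≤ e → e < x ^ 2 + (y + 1) ^ 2 → x ≤ y := by
    intro x y hx hy
    by_contra hh
    have := sq (y + 1) x (by omega)
    omega
  have high : ∀ x y : ℕ, ¬ 2 * x ^ 2 ≤ e → x ^ 2 + y ^ 2 ≤ e → y + 1 ≤ x := by
    intro x y hx hy
    by_contra hh
    have := sq x y (by omega)
    omega
  split_ifs at h with ha hb hb
  · have := low c m (k1.1 ha) h2
    have := low c' n (k2.1 hb) h4
    omega
  · have i1 := low c m (k1.1 ha) h2
    have i2 := high c' n (fun h => hb (k2.2 h)) h3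
    rcases le_or_gt c' m with h5 | h5
    · have h6 : n + 1 ≤ c := by omega
      have := sq _ _ h6
      have := sq _ _ h5
      omega
    · have h6 : c ≤ n := by omega
      have := sq _ _ h6
      have := sq (m + 1) c' (by omega)
      omega
  · omega
  · have i2 := high c' n (fun h => hb (k2.2 h)) h3
    have i3 := high c m (fun h => ha (k1.2 h)) h1
    omega

/-- the sorted list of integer coordinates of the vertices -/
def cList (e : ℕ) : List ℕ :=
  (List.range (Nat.sqrt e + 1)).mergeSort (fun c c' => vidx e c ≤ vidx e c')

lemma cList_mem (e c : ℕ) : c ∈ cList e ↔ c ≤ Nat.sqrt e := by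
  unfold cList
  rw [(List.mergeSort_perm _ _).mem_iff, List.mem_range]
  omega

lemma cList_sorted (e : ℕ) : (cList e).Pairwise (fun a b => vidx e a < vidx e b) := by
  have h1 : (cList e).Pairwise (fun a b => (decide (vidx e a ≤ vidx e b)) = true) := by
    unfold cList
    apply List.pairwise_mergeSort
    · intro a b c; simp; omega
    · intro a b; simp; omega
  have h2 : (cList e).Pairwise (· ≠ ·) := by
    have : (cList e).Nodup := by
      unfold cList
      exact (List.mergeSort_perm _ _).nodup_iff.2 List.nodup_range
    exact this
  refine List.Pairwise.imp_of_mem ?_ (h1.and h2)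
  intro a b ha hb hab
  rw [cList_mem] at ha hb
  obtain ⟨h3, h4⟩ := hab
  simp at h3
  rcases lt_or_eq_of_le h3 with h | h
  · exact h
  · exfalso
    rcases lt_or_gt_of_ne h4 with h5 | h5
    · exact vidx_inj e ha hb h5 h
    · exact vidx_inj e hb ha h5 h.symm

lemma vertexList_eq (e : ℕ) : vertexList e = (cList e).map (fun c => Nat.sqrt (e - c ^ 2)) := rfl

lemma dvd_foldr_lcm (l : List ℕ) (a x : ℕ) (hx : x ∈ l) : x ∣ l.foldr Nat.lcm a := by
  induction l with
  | nil => simp at hx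
  | cons b l ih =>
    rcases List.mem_cons.1 hx with h | h
    · subst h; exact Nat.dvd_lcm_left _ _
    · exact (ih h).trans (Nat.dvd_lcm_right _ _)

lemma base_dvd_foldr_lcm (l : List ℕ) (a : ℕ) : a ∣ l.foldr Nat.lcm a := by
  induction l with
  | nil => simp
  | cons b l ih => exact ih.trans (Nat.dvd_lcm_right _ _)

lemma odd_foldr_lcm (l : List ℕ) (a : ℕ) (ha : Odd a) (hl : ∀ x ∈ l, Odd x) :
    Odd (l.foldr Nat.lcm a) := by
  induction l with
  | nil => simpa
  | cons b l ih =>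
    have h1 := ih (fun x hx => hl x (List.mem_cons_of_mem _ hx))
    have h2 := hl b (by simp)
    simp only [List.foldr_cons]
    exact Odd.of_dvd_nat (h2.mul h1) (Nat.lcm_dvd_mul _ _)

lemma qe_odd (e : ℕ) : Odd (qe e) := by
  unfold qe
  apply odd_foldr_lcm
  · exact Odd.pow ⟨_, rfl⟩
  · intro x hx
    rw [List.mem_map] at hx
    obtain ⟨p, _, rfl⟩ := hx
    exact Odd.mul ⟨_, rfl⟩ ⟨_, rfl⟩

lemma distinct_adj (e : ℕ) {c c' : ℕ} (hc : c ≤ Nat.sqrt e) (hc' : c' ≤ Nat.sqrt e)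
    (hf : vidx e c' = vidx e c + 1) (hne : Nat.sqrt (e - c ^ 2) ≠ Nat.sqrt (e - c' ^ 2)) :
    ((2 * Nat.sqrt (e - c ^ 2) + 1) * (2 * Nat.sqrt (e - c' ^ 2) + 1)) ∣ qe e := by
  obtain ⟨L1, L2, hL⟩ := sorted_adj (cList_sorted e) ((cList_mem e c).2 hc)
    ((cList_mem e c').2 hc') hf
  have hV : vertexList e = L1.map (fun c => Nat.sqrt (e - c ^ 2)) ++ Nat.sqrt (e - c ^ 2) ::
      Nat.sqrt (e - c' ^ 2) :: L2.map (fun c => Nat.sqrt (e - c ^ 2)) := by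
    rw [vertexList_eq, hL]; simp
  have hd : ∃ A B, distinctTypes e = A ++ Nat.sqrt (e - c ^ 2) :: Nat.sqrt (e - c' ^ 2) :: B := by
    unfold distinctTypes
    rcases hv : vertexList e with _ | ⟨a, l⟩
    · rw [hv] at hV; simp at hV
    · rw [List.destutter_cons']
      exact destutter'_adj a l _ _ _ _ hne (hv ▸ hV)
  obtain ⟨A, B, hAB⟩ := hd
  unfold qe
  apply dvd_foldr_lcm
  rw [List.mem_map]
  refine ⟨(Nat.sqrt (e - c ^ 2), Nat.sqrt (e - c' ^ 2)), ?_, rfl⟩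
  rw [hAB]
  clear hAB hV hL hne hf
  generalize Nat.sqrt (e - c ^ 2) = t
  generalize Nat.sqrt (e - c' ^ 2) = t'
  induction A with
  | nil => simp
  | cons a A ih =>
    rcases A with _ | ⟨b, A⟩
    · simp
    · simp only [List.cons_append, List.tail_cons, List.zip_cons_cons] at ih ⊢
      exact List.mem_cons_of_mem _ ih

lemma head_type (e : ℕ) : ∃ L, vertexList e = Nat.sqrt (e / 2) :: L := by
  obtain ⟨h1, h2⟩ := v1_spec e
  set v := Nat.sqrt (e / 2) with hv
  rcases lt_or_ge e (v ^ 2 + (v + 1) ^ 2) with h | h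
  · have hs : Nat.sqrt (e - v ^ 2) = v := sqrt_eq_of e v v (by omega) h
    have hm : v ∈ cList e := by rw [cList_mem, Nat.le_sqrt']; nlinarith
    have hx : vidx e v = 0 := by unfold vidx; rw [← hv, hs]; simp
    obtain ⟨L, hL⟩ := sorted_head (cList_sorted e) hm hx
    exact ⟨L.map (fun c => Nat.sqrt (e - c ^ 2)), by rw [vertexList_eq, hL]; simp [hs]⟩
  · have hs : Nat.sqrt (e - (v + 1) ^ 2) = v := sqrt_eq_of e (v + 1) v (by omega) (by nlinarith)
    have hm : v + 1 ∈ cList e := by rw [cList_mem, Nat.le_sqrt']; nlinarith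
    have hx : vidx e (v + 1) = 0 := by unfold vidx; rw [← hv, hs]; simp
    obtain ⟨L, hL⟩ := sorted_head (cList_sorted e) hm hx
    exact ⟨L.map (fun c => Nat.sqrt (e - c ^ 2)), by rw [vertexList_eq, hL]; simp [hs]⟩

lemma head_distinct (e : ℕ) : ∃ L, distinctTypes e = Nat.sqrt (e / 2) :: L := by
  obtain ⟨L, hL⟩ := head_type e
  unfold distinctTypes
  rw [hL, List.destutter_cons']
  exact destutter'_head _ _

lemma v1_sq_dvd (e : ℕ) : (2 * Nat.sqrt (e / 2) + 1) ^ 2 ∣ qe e := by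
  obtain ⟨L, hL⟩ := head_distinct e
  unfold qe
  have := base_dvd_foldr_lcm (((distinctTypes e).zip (distinctTypes e).tail).map
      (fun p => (2*p.1+1) * (2*p.2+1))) ((2 * (distinctTypes e).headD 0 + 1)^2)
  rw [hL] at this ⊢
  exact this

lemma type_dvd (e c : ℕ) (hc : c ≤ Nat.sqrt e) : (2 * Nat.sqrt (e - c ^ 2) + 1) ∣ qe e := by
  have hV : Nat.sqrt (e - c ^ 2) ∈ vertexList e := by
    rw [vertexList_eq]; exact List.mem_map_of_mem ((cList_mem e c).2 hc)
  have hD : Nat.sqrt (e - c ^ 2) ∈ distinctTypes e := by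
    unfold distinctTypes
    rcases hv : vertexList e with _ | ⟨a, l⟩
    · rw [hv] at hV; simp at hV
    · rw [List.destutter_cons']
      exact destutter'_mem a l _ (hv ▸ hV)
  have hb := v1_sq_dvd e
  obtain ⟨L, hL⟩ := head_distinct e
  generalize Nat.sqrt (e - c ^ 2) = t at *
  have key : ∀ (d : List ℕ) (a : ℕ), t ∈ a :: d → t = a ∨
      ∃ x, (x, t) ∈ (a :: d).zip d := by
    intro d
    induction d with
    | nil => intro a h; left; simpa using h
    | cons b d ih =>
      intro a h
      rcases List.mem_cons.1 h with h | h
      · left; exact h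
      · right
        rcases ih b h with h | ⟨x, hx⟩
        · exact ⟨a, by simp [h]⟩
        · exact ⟨x, by rw [List.zip_cons_cons]; exact List.mem_cons_of_mem _ hx⟩
  rw [hL] at hD
  rcases key _ _ hD with h | ⟨x, hx⟩
  · subst h; exact (dvd_pow_self _ (by norm_num)).trans hb
  · unfold qe
    have : (2 * x + 1) * (2 * t + 1) ∣ (((distinctTypes e).zip (distinctTypes e).tail).map
      (fun p => (2*p.1+1) * (2*p.2+1))).foldr Nat.lcm
        ((2 * (distinctTypes e).headD 0 + 1)^2) := by
      apply dvd_foldr_lcm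
      rw [List.mem_map]
      refine ⟨(x, t), ?_, rfl⟩
      rw [hL]
      exact hx
    exact (Dvd.intro_left _ rfl).trans this

lemma adj1_nat (e m n : ℕ) (hnm : n < m) (h1 : m ^ 2 + (n + 1) ^ 2 ≤ e)
    (h2 : (m + 1) ^ 2 + n ^ 2 ≤ e) (h3 : e < (m + 1) ^ 2 + (n + 1) ^ 2) :
    (2 * m + 1) * (2 * n + 1) ∣ qe e := by
  have s1 : Nat.sqrt (e - (n + 1) ^ 2) = m := sqrt_eq_of e (n + 1) m (by omega) (by omega)
  have s2 : Nat.sqrt (e - (m + 1) ^ 2) = n := sqrt_eq_of e (m + 1) n (by omega) (by omega)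
  have c1 : n + 1 ≤ Nat.sqrt e := by rw [Nat.le_sqrt']; nlinarith
  have c2 : m + 1 ≤ Nat.sqrt e := by rw [Nat.le_sqrt']; nlinarith
  have := distinct_adj e c1 c2 ?_ (by rw [s1, s2]; omega)
  · rwa [s1, s2] at this
  · unfold vidx
    rw [if_neg (by rw [le_v1_iff]; nlinarith), if_pos ((le_v1_iff _ _).2 (by nlinarith)), s1, s2]
    omega

lemma adj2_nat (e m n : ℕ) (hnm : n < m) (h1 : m ^ 2 + n ^ 2 ≤ e)
    (h2 : e < m ^ 2 + (n + 1) ^ 2) (h3 : e < (m + 1) ^ 2 + n ^ 2) :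
    (2 * m + 1) * (2 * n + 1) ∣ qe e := by
  have s1 : Nat.sqrt (e - n ^ 2) = m := sqrt_eq_of e n m (by omega) (by omega)
  have s2 : Nat.sqrt (e - m ^ 2) = n := sqrt_eq_of e m n (by omega) (by omega)
  have c1 : n ≤ Nat.sqrt e := by rw [Nat.le_sqrt']; nlinarith
  have c2 : m ≤ Nat.sqrt e := by rw [Nat.le_sqrt']; nlinarith
  have := distinct_adj e c2 c1 ?_ (by rw [s1, s2]; omega)
  · rw [s1, s2] at this; rwa [mul_comm]
  · unfold vidx
    rw [if_pos ((le_v1_iff e n).2 (by nlinarith)), if_neg (by rw [le_v1_iff]; nlinarith), s1, s2]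
    omega

lemma adj1 (e : ℕ) (m n : ℤ) (hn : 0 ≤ n) (hnm : n < m) (h1 : m ^ 2 + (n + 1) ^ 2 ≤ e)
    (h2 : (m + 1) ^ 2 + n ^ 2 ≤ e) (h3 : (e : ℤ) < (m + 1) ^ 2 + (n + 1) ^ 2) :
    (2 * m + 1) * (2 * n + 1) ∣ (qe e : ℤ) := by
  lift n to ℕ using hn
  lift m to ℕ using by omega
  exact_mod_cast adj1_nat e m n (by exact_mod_cast hnm) (by exact_mod_cast h1)
    (by exact_mod_cast h2) (by exact_mod_cast h3)

lemma adj2 (e : ℕ) (m n : ℤ) (hn : 0 ≤ n) (hnm : n < m) (h1 : m ^ 2 + n ^ 2 ≤ e)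
    (h2 : (e : ℤ) < m ^ 2 + (n + 1) ^ 2) (h3 : (e : ℤ) < (m + 1) ^ 2 + n ^ 2) :
    (2 * m + 1) * (2 * n + 1) ∣ (qe e : ℤ) := by
  lift n to ℕ using hn
  lift m to ℕ using by omega
  exact_mod_cast adj2_nat e m n (by exact_mod_cast hnm) (by exact_mod_cast h1)
    (by exact_mod_cast h2) (by exact_mod_cast h3)

lemma adj0 (e : ℕ) (m : ℤ) (hm : 0 ≤ m) (h1 : m ^ 2 ≤ e) (h2 : (e : ℤ) < (m + 1) ^ 2) :
    (2 * m + 1) ∣ (qe e : ℤ) := by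
  lift m to ℕ using hm
  have := type_dvd e 0 (by simp)
  rw [sqrt_eq_of e 0 m (by norm_num; exact_mod_cast h1) (by norm_num; exact_mod_cast h2)] at this
  exact_mod_cast this

lemma nextE_le (e : ℕ) (m n : ℤ) (h : (m : ℝ) ^ 2 + (n : ℝ) ^ 2 < nextE e) :
    m ^ 2 + n ^ 2 ≤ (e : ℤ) := by
  by_contra hc
  push Not at hc
  have h0 : 0 ≤ m ^ 2 + n ^ 2 := by positivity
  obtain ⟨f, hf⟩ := Int.eq_ofNat_of_zero_le h0
  have : nextE e ≤ f := by
    unfold nextE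
    apply Nat.sInf_le
    refine ⟨?_, m, n, hf.symm⟩
    rw [hf] at hc; exact_mod_cast hc
  have h2 : ((m ^ 2 + n ^ 2 : ℤ) : ℝ) = f := by rw [hf]; simp
  push_cast at h2
  rw [h2] at h
  have : (nextE e : ℝ) ≤ f := by exact_mod_cast this
  linarith

/-- the lattice in coordinates -/
lemma lattice_coords (e : ℕ) (l : ℤ × ℤ) (hl : l ∈ latticeE e) :
    ∃ K t S : ℤ, S * (2 * (Nat.sqrt (e / 2) : ℤ) + 1) = K * qe e ∧
      l = (t * (2 * (Nat.sqrt (e / 2) : ℤ) + 1), S - t * (2 * (Nat.sqrt (e / 2) : ℤ) + 1)) := by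
  obtain ⟨r, hr⟩ := v1_sq_dvd e
  have hodd := qe_odd e
  have hr' : Odd r := by rw [hr] at hodd; exact (Nat.odd_mul.1 hodd).2
  obtain ⟨k, hk⟩ := hr'
  have hq : (qe e : ℤ) = (2 * (Nat.sqrt (e / 2) : ℤ) + 1) ^ 2 * (2 * k + 1) := by
    rw [hr, hk]; push_cast; ring
  unfold latticeE at hl
  rw [AddSubgroup.mem_closure_pair] at hl
  obtain ⟨a, b, rfl⟩ := hl
  have hL : Lvec e = ((2 * (Nat.sqrt (e / 2) : ℤ) + 1) * (2 * k + 1),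
      (2 * (Nat.sqrt (e / 2) : ℤ) + 1) * (2 * k + 1)) := by
    unfold Lvec
    have : (qe e : ℤ) / (2 * (Nat.sqrt (e / 2) : ℤ) + 1)
      = (2 * (Nat.sqrt (e / 2) : ℤ) + 1) * (2 * k + 1) := by
      rw [hq]
      apply Int.ediv_eq_of_eq_mul_right
      · positivity
      · ring
    rw [this]
  have hM : Mvec e = ((2 * (Nat.sqrt (e / 2) : ℤ) + 1) * k,
      (2 * (Nat.sqrt (e / 2) : ℤ) + 1) * (k + 1)) := by
    unfold Mvec
    rw [hL]
    unfold w1vec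
    simp only
    ext
    · simp only
      apply Int.ediv_eq_of_eq_mul_right (by norm_num)
      ring
    · simp only
      apply Int.ediv_eq_of_eq_mul_right (by norm_num)
      ring
  rw [hL, hM, hq]
  refine ⟨2 * a + b, a * (2 * k + 1) + b * k,
    (2 * a + b) * (2 * (Nat.sqrt (e / 2) : ℤ) + 1) * (2 * k + 1), by ring, ?_⟩
  ext
  · simp; ring
  · simp; ring



/-! ### Basic facts on the map -/

/-- `m` is the floor of `lam * x` -/
def Flr (lam : ℝ) (x m : ℤ) : Prop := (m : ℝ) ≤ lam * x ∧ lam * x < m + 1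

lemma flr_floor (lam : ℝ) (x : ℤ) : Flr lam x ⌊lam * x⌋ :=
  ⟨Int.floor_le _, Int.lt_floor_add_one _⟩

lemma flr_iff {lam : ℝ} {x m : ℤ} : Flr lam x m ↔ ⌊lam * (x : ℝ)⌋ = m := Int.floor_eq_iff.symm

lemma flr_unique {lam : ℝ} {x m n : ℤ} (h1 : Flr lam x m) (h2 : Flr lam x n) : m = n := by
  rw [flr_iff] at h1 h2; omega

lemma le_of_lt1 {a b : ℤ} (h : (a : ℝ) < b + 1) : a ≤ b := by
  have : a < b + 1 := by exact_mod_cast h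
  omega

lemma flr_le {lam : ℝ} {x y m n : ℤ} (hl : 0 < lam) (h1 : Flr lam x m) (h2 : Flr lam y n)
    (h : x ≤ y) : m ≤ n := by
  apply le_of_lt1
  have : lam * (x : ℝ) ≤ lam * y := mul_le_mul_of_nonneg_left (by exact_mod_cast h) hl.le
  linarith [h1.1, h2.2]

lemma lmul_le {lam : ℝ} {x y : ℤ} (hl : 0 < lam) (h : x ≤ y) : lam * (x : ℝ) ≤ lam * y :=
  mul_le_mul_of_nonneg_left (by exact_mod_cast h) hl.le

lemma lmul_lt {lam : ℝ} {x y : ℤ} (hl : 0 < lam) (h : x < y) : lam * (x : ℝ) < lam * y :=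
  mul_lt_mul_of_pos_left (by exact_mod_cast h) hl

lemma of_lmul_lt {lam : ℝ} {x y : ℤ} (hl : 0 < lam) (h : lam * (x : ℝ) < lam * y) : x < y := by
  by_contra hc
  have := lmul_le hl (not_lt.1 hc)
  linarith

lemma of_lmul_le {lam : ℝ} {x y : ℤ} (hl : 0 < lam) (h : lam * (x : ℝ) ≤ lam * y) : x ≤ y := by
  by_contra hc
  have := lmul_lt hl (not_le.1 hc)
  linarith

lemma Fe_apply (lam : ℝ) (x y : ℤ) : Fe lam (x, y) = (⌊lam * (x : ℝ)⌋ - y, x) := rfl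

lemma Fe_flr {lam : ℝ} {x y m : ℤ} (h : Flr lam x m) : Fe lam (x, y) = (m - y, x) := by
  rw [Fe_apply, flr_iff.1 h]

lemma Fei_apply (lam : ℝ) (x y : ℤ) : (Fe lam).symm (x, y) = (y, ⌊lam * (y : ℝ)⌋ - x) := rfl

lemma Fei_flr {lam : ℝ} {x y m : ℤ} (h : Flr lam y m) : (Fe lam).symm (x, y) = (y, m - x) := by
  rw [Fei_apply, flr_iff.1 h]

/-- the intermediate floors of `F^4` -/
structure Chain (lam : ℝ) (x y m a b c : ℤ) : Prop where
  hm : Flr lam x m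
  ha : Flr lam (m - y) a
  hb : Flr lam (a - x) b
  hc : Flr lam (y + b - m) c

lemma chain_exists (lam : ℝ) (x y : ℤ) : ∃ m a b c, Chain lam x y m a b c :=
  ⟨_, _, _, _, flr_floor _ _, flr_floor _ _, flr_floor _ _, flr_floor _ _⟩

lemma Chain.F4 {lam : ℝ} {x y m a b c : ℤ} (h : Chain lam x y m a b c) :
    (Fe lam ^ 4) (x, y) = (x + c - a, y + b - m) := by
  have e4 : (Fe lam ^ 4) (x, y) = Fe lam (Fe lam (Fe lam (Fe lam (x, y)))) := rfl
  have h3 : Flr lam (b - (m - y)) c := by have := h.hc; convert this using 1; ring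
  rw [e4, Fe_flr h.hm, Fe_flr h.ha, Fe_flr h.hb, Fe_flr h3]
  ext <;> simp <;> ring

/-- the intermediate floors of `F^(-4)` -/
structure IChain (lam : ℝ) (x y m1 m2 m3 m4 : ℤ) : Prop where
  h1 : Flr lam y m1
  h2 : Flr lam (m1 - x) m2
  h3 : Flr lam (m2 - y) m3
  h4 : Flr lam (m3 - m1 + x) m4

lemma ichain_exists (lam : ℝ) (x y : ℤ) : ∃ m1 m2 m3 m4, IChain lam x y m1 m2 m3 m4 :=
  ⟨_, _, _, _, flr_floor _ _, flr_floor _ _, flr_floor _ _, flr_floor _ _⟩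

lemma IChain.F4 {lam : ℝ} {x y m1 m2 m3 m4 : ℤ} (h : IChain lam x y m1 m2 m3 m4) :
    (Fe lam ^ (-4 : ℤ)) (x, y) = (x + m3 - m1, y + m4 - m2) := by
  have e4 : (Fe lam ^ (-4 : ℤ)) (x, y)
      = (Fe lam).symm ((Fe lam).symm ((Fe lam).symm ((Fe lam).symm (x, y)))) := rfl
  have h4 : Flr lam (m3 - (m1 - x)) m4 := by have := h.h4; convert this using 1; ring
  rw [e4, Fei_flr h.h1, Fei_flr h.h2, Fei_flr h.h3, Fei_flr h4]
  ext <;> simp <;> ring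

lemma dline_pt {lam : ℝ} (hl : 0 < lam) (x y : ℤ) :
    dline (pt lam (x, y)) = lam * ((|x - y| : ℤ) : ℝ) / Real.sqrt 2 := by
  unfold dline pt
  simp only
  rw [← mul_sub, abs_mul, abs_of_pos hl]
  push_cast
  rfl

lemma dline_le {lam : ℝ} (hl : 0 < lam) (p q : ℤ × ℤ) :
    dline (pt lam p) ≤ dline (pt lam q) ↔ |p.1 - p.2| ≤ |q.1 - q.2| := by
  rw [← Prod.mk.eta (p := p), ← Prod.mk.eta (p := q), dline_pt hl, dline_pt hl]
  rw [div_le_div_iff_of_pos_right (by positivity), mul_le_mul_iff_right₀ hl]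
  norm_cast

lemma dline_lt {lam : ℝ} (hl : 0 < lam) (p q : ℤ × ℤ) :
    dline (pt lam p) < dline (pt lam q) ↔ |p.1 - p.2| < |q.1 - q.2| := by
  rw [lt_iff_not_ge, dline_le hl, not_le]

lemma X_iff {lam : ℝ} (hl : 0 < lam) (p : ℤ × ℤ) :
    p ∈ Xset lam ↔ 0 ≤ p.1 ∧ 0 ≤ p.2 ∧
      |p.1 - p.2| ≤ |((Fe lam ^ 4) p).1 - ((Fe lam ^ 4) p).2| ∧
      |p.1 - p.2| < |((Fe lam ^ (-4 : ℤ)) p).1 - ((Fe lam ^ (-4 : ℤ)) p).2| := by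
  unfold Xset
  rw [Set.mem_setOf_eq, dline_le hl, dline_lt hl]

lemma Rmap_iff {lam : ℝ} {x y m n : ℤ} :
    Rmap (pt lam (x, y)) = (m, n) ↔ Flr lam x m ∧ Flr lam y n := by
  unfold Rmap pt
  simp only [Prod.mk.injEq, flr_iff]

lemma not_trans_iff {lam : ℝ} {x y x' y' m n : ℤ} (h : (Fe lam ^ 4) (x, y) = (x', y'))
    (hx : Flr lam x m) (hy : Flr lam y n) :
    ¬ IsTransition lam (x, y) ↔ Flr lam x' m ∧ Flr lam y' n := by
  unfold IsTransition
  rw [h, not_not, Rmap_iff.2 ⟨hx, hy⟩, Rmap_iff]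

lemma ham_box {lam : ℝ} {x y m n : ℤ} (hx : Flr lam x m) (hy : Flr lam y n) :
    ham (pt lam (x, y)) = (m : ℝ)^2 + (2 * m + 1) * (lam * x - m) +
      ((n : ℝ)^2 + (2 * n + 1) * (lam * y - n)) := by
  unfold ham pt Pfun
  simp only
  rw [flr_iff.1 hx, flr_iff.1 hy]

lemma ham_expand {lam : ℝ} {x y m n : ℤ} (hx : Flr lam x m) (hy : Flr lam y n) :
    ham (pt lam (x, y)) = 2 * m * (lam * x) + lam * x - (m : ℝ)^2 - m +
      (2 * n * (lam * y) + lam * y - (n : ℝ)^2 - n) := by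
  rw [ham_box hx hy]; ring

lemma ham_pos_bounds {lam : ℝ} {e : ℕ} {x y m n : ℤ} (hx : Flr lam x m) (hy : Flr lam y n)
    (hm : 0 ≤ m) (hn : 0 ≤ n) (h : ham (pt lam (x, y)) ∈ Ie e) :
    m ^ 2 + n ^ 2 ≤ (e : ℤ) ∧ (e : ℤ) < (m + 1) ^ 2 + (n + 1) ^ 2 := by
  obtain ⟨h1, h2⟩ := h
  rw [ham_box hx hy] at h1 h2
  have hm' : (0:ℝ) ≤ m := by exact_mod_cast hm
  have hn' : (0:ℝ) ≤ n := by exact_mod_cast hn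
  have a1 := mul_nonneg (show (0:ℝ) ≤ 2 * m + 1 by linarith) (sub_nonneg.2 hx.1)
  have a2 := mul_nonneg (show (0:ℝ) ≤ 2 * n + 1 by linarith) (sub_nonneg.2 hy.1)
  have b1 := mul_pos (show (0:ℝ) < 2 * m + 1 by linarith) (sub_pos.2 hx.2)
  have b2 := mul_pos (show (0:ℝ) < 2 * n + 1 by linarith) (sub_pos.2 hy.2)
  constructor
  · apply nextE_le
    linarith
  · have : (e : ℝ) < (m + 1) ^ 2 + (n + 1) ^ 2 := by nlinarith
    exact_mod_cast this

lemma ham_neg_bounds {lam : ℝ} {e : ℕ} {x y m n : ℤ} (hx : Flr lam x m) (hy : Flr lam y n)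
    (hm : 0 ≤ m) (hn : n < 0) (h : ham (pt lam (x, y)) ∈ Ie e) :
    m ^ 2 + (n + 1) ^ 2 ≤ (e : ℤ) ∧ (e : ℤ) < (m + 1) ^ 2 + n ^ 2 := by
  obtain ⟨h1, h2⟩ := h
  rw [ham_box hx hy] at h1 h2
  have hm' : (0:ℝ) ≤ m := by exact_mod_cast hm
  have hn' : (n:ℝ) ≤ -1 := by exact_mod_cast (by omega : n ≤ -1)
  have a1 := mul_nonneg (show (0:ℝ) ≤ 2 * m + 1 by linarith) (sub_nonneg.2 hx.1)
  have a2 := mul_nonneg (show (0:ℝ) ≤ -(2 * n + 1) by linarith) (sub_nonneg.2 hy.1)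
  have b1 := mul_pos (show (0:ℝ) < 2 * m + 1 by linarith) (sub_pos.2 hx.2)
  have b2 := mul_pos (show (0:ℝ) < -(2 * n + 1) by linarith) (sub_pos.2 hy.2)
  constructor
  · apply nextE_le
    push_cast
    nlinarith
  · have : (e : ℝ) < (m + 1) ^ 2 + n ^ 2 := by nlinarith
    exact_mod_cast this

/-- in a non-transition step the motion is the local integrable one -/
lemma nontrans_core {lam : ℝ} {x y m n a b c : ℤ} (hl : 0 < lam) (h : Chain lam x y m a b c)
    (hy : Flr lam y n) (hm : 0 ≤ m) (hax : a < x) (ha1 : lam * (a : ℝ) < 1)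
    (hx' : Flr lam (x + c - a) m) (hy' : Flr lam (y + b - m) n) :
    c = n ∧ a = -n - 1 ∧ b = -m - 1 := by
  have hc : c = n := flr_unique h.hc hy'
  subst hc
  obtain ⟨⟨m1, m2⟩, ⟨a1, a2⟩, ⟨b1, b2⟩, ⟨c1, c2⟩⟩ := h
  obtain ⟨x1, x2⟩ := hx'
  obtain ⟨y1, y2⟩ := hy
  push_cast at *
  have lax := lmul_lt hl hax
  have hb1 : b ≤ -1 := by
    apply le_of_lt1; push_cast; linarith
  have hbm : b ≤ -m := by
    apply le_of_lt1; push_cast; linarith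
  have l1 := lmul_le hl (show b ≤ -1 from hb1)
  have l2 := lmul_le hl hm
  push_cast at l1 l2
  have ha : a = -c - 1 := by
    apply le_antisymm
    · apply le_of_lt1; push_cast; linarith
    · apply le_of_lt1; push_cast; linarith
  subst ha
  refine ⟨rfl, rfl, ?_⟩
  push_cast at *
  rcases le_or_gt 0 c with h0 | h0
  · have := lmul_le hl h0
    push_cast at this
    apply le_antisymm <;> apply le_of_lt1 <;> push_cast <;> linarith
  · have := lmul_le hl (show c ≤ -1 by omega)
    push_cast at this
    apply le_antisymm <;> apply le_of_lt1 <;> push_cast <;> linarith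

lemma nontrans_step {lam : ℝ} {x y m n a b c : ℤ} (hl : 0 < lam) (h : Chain lam x y m a b c)
    (hy : Flr lam y n) (hm : 0 ≤ m) (hax : a < x) (ha1 : lam * (a : ℝ) < 1)
    (ht : ¬ IsTransition lam (x, y)) :
    c = n ∧ a = -n - 1 ∧ b = -m - 1 ∧
      (Fe lam ^ 4) (x, y) = (x + (2 * n + 1), y - (2 * m + 1)) ∧
      Flr lam (x + (2 * n + 1)) m ∧ Flr lam (y - (2 * m + 1)) n := by
  have h4 := h.F4
  rw [not_trans_iff h4 h.hm hy] at ht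
  obtain ⟨hc, ha, hb⟩ := nontrans_core hl h hy hm hax ha1 ht.1 ht.2
  subst hc ha hb
  have e1 : x + c - (-c - 1) = x + (2 * c + 1) := by ring
  have e2 : y + (-m - 1) - m = y - (2 * m + 1) := by ring
  rw [e1, e2] at ht
  rw [e1, e2] at h4
  exact ⟨rfl, rfl, rfl, h4, ht.1, ht.2⟩

/-- for nonnegative nonzero points the size hypotheses of `nontrans_step` hold -/
lemma nonneg_core {lam : ℝ} {x y m a b c : ℤ} (hl : 0 < lam) (hl1 : lam < 1)
    (h : Chain lam x y m a b c)
    (hx : 0 ≤ x) (hy : 0 ≤ y) (hxy : 0 < x + y) (hsm : lam * (m : ℝ) < 1) :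
    0 ≤ m ∧ a ≤ 0 ∧ a < x ∧ lam * (a : ℝ) < 1 := by
  have lx := lmul_le hl hx
  have ly := lmul_le hl hy
  push_cast at lx ly
  obtain ⟨⟨m1, m2⟩, ⟨a1, a2⟩, _, _⟩ := h
  push_cast at *
  have hm : 0 ≤ m := by apply le_of_lt1; push_cast; linarith
  have ha : a ≤ 0 := by apply le_of_lt1; push_cast; linarith
  have la := lmul_le hl ha
  push_cast at la
  refine ⟨hm, ha, ?_, by linarith⟩
  rcases lt_or_eq_of_le hx with h0 | h0
  · omega
  · subst h0
    have hm0 : m ≤ 0 := by apply le_of_lt1; push_cast at *; linarith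
    have hm0 : m = 0 := by omega
    subst hm0
    have := lmul_lt hl (show 0 < y by omega)
    push_cast at *
    have : a < 0 := by
      have : (a:ℝ) < 0 := by linarith
      exact_mod_cast this
    omega

lemma zpow_nat_apply (lam : ℝ) (k : ℕ) (p : ℤ × ℤ) : (Fe lam ^ (k : ℤ)) p = (Fe lam ^ k) p := by
  rw [zpow_natCast]

lemma not_sig {lam : ℝ} {x y : ℤ} (hs : (x, y) ∉ SigSet lam) (ht : IsTransition lam (x, y))
    (m n : ℤ) (hx1 : lam * (x:ℝ) - m ≤ lam * (((max |2*n+1| |2*m+1| : ℤ) : ℝ) + 2))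
    (hx2 : -(lam * (((max |2*n+1| |2*m+1| : ℤ) : ℝ) + 2)) ≤ lam * (x:ℝ) - m)
    (hy1 : lam * (y:ℝ) - n ≤ lam * (((max |2*n+1| |2*m+1| : ℤ) : ℝ) + 2))
    (hy2 : -(lam * (((max |2*n+1| |2*m+1| : ℤ) : ℝ) + 2)) ≤ lam * (y:ℝ) - n) : False := by
  apply hs
  refine ⟨ht, m, n, ?_⟩
  exact max_le (abs_le.2 ⟨hx2, hx1⟩) (abs_le.2 ⟨hy2, hy1⟩)

/-- a convenient form: any integer bound `B` below the Sigma radius -/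
lemma not_sig' {lam : ℝ} {x y : ℤ} (hl : 0 < lam) (hs : (x, y) ∉ SigSet lam)
    (ht : IsTransition lam (x, y)) (m n B : ℤ) (hB : B ≤ |2*n+1| + 2 ∨ B ≤ |2*m+1| + 2)
    (hx1 : lam * (x:ℝ) - m ≤ lam * (B:ℝ)) (hx2 : -(lam * (B:ℝ)) ≤ lam * (x:ℝ) - m)
    (hy1 : lam * (y:ℝ) - n ≤ lam * (B:ℝ)) (hy2 : -(lam * (B:ℝ)) ≤ lam * (y:ℝ) - n) : False := by
  have hB' : B ≤ max |2*n+1| |2*m+1| + 2 := by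
    rcases hB with h | h
    · have := le_max_left |2*n+1| |2*m+1|; omega
    · have := le_max_right |2*n+1| |2*m+1|; omega
  have := lmul_le hl hB'
  rw [Int.cast_add] at this
  apply not_sig hs ht m n <;> push_cast at * <;> linarith



/-! ### Orbits and the return time -/

/-- the orbit of `p` under `F^4` with all intermediate floors -/
structure Orb (lam : ℝ) (p : ℤ × ℤ) (x y m a b c : ℕ → ℤ) : Prop where
  h0 : p = (x 0, y 0)
  ch : ∀ i, Chain lam (x i) (y i) (m i) (a i) (b i) (c i)
  sx : ∀ i, x (i + 1) = x i + c i - a i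
  sy : ∀ i, y (i + 1) = y i + b i - m i

lemma orb_exists (lam : ℝ) (p : ℤ × ℤ) : ∃ x y m a b c, Orb lam p x y m a b c := by
  choose m a b c h using chain_exists lam
  let Z : ℕ → ℤ × ℤ := fun i => ((Fe lam ^ 4) ^ i) p
  have hZ : ∀ i, Z (i + 1) = (Fe lam ^ 4) (Z i) := by
    intro i; simp only [Z]; rw [pow_succ']; rfl
  refine ⟨fun i => (Z i).1, fun i => (Z i).2, fun i => m (Z i).1 (Z i).2, fun i => a (Z i).1 (Z i).2,
    fun i => b (Z i).1 (Z i).2, fun i => c (Z i).1 (Z i).2, rfl, fun i => h _ _, ?_, ?_⟩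
  · intro i
    have := hZ i
    rw [← Prod.mk.eta (p := Z i), (h _ _).F4] at this
    simp only [this]
  · intro i
    have := hZ i
    rw [← Prod.mk.eta (p := Z i), (h _ _).F4] at this
    simp only [this]

section
variable {lam : ℝ} {p : ℤ × ℤ} {x y m a b c : ℕ → ℤ}

lemma Orb.step (h : Orb lam p x y m a b c) (i : ℕ) :
    (Fe lam ^ 4) (x i, y i) = (x (i + 1), y (i + 1)) := by
  rw [(h.ch i).F4, h.sx, h.sy]

lemma Orb.pow (h : Orb lam p x y m a b c) (i : ℕ) : (Fe lam ^ (4 * i)) p = (x i, y i) := by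
  induction i with
  | zero => simp [h.h0]
  | succ i ih =>
    rw [show 4 * (i + 1) = 4 + 4 * i by ring, pow_add, Equiv.Perm.mul_apply, ih, h.step]

lemma Orb.pow1 (h : Orb lam p x y m a b c) (i : ℕ) :
    (Fe lam ^ (4 * i + 1)) p = (m i - y i, x i) := by
  rw [pow_succ', Equiv.Perm.mul_apply, h.pow, Fe_flr (h.ch i).hm]

lemma Orb.pow2 (h : Orb lam p x y m a b c) (i : ℕ) :
    (Fe lam ^ (4 * i + 2)) p = (a i - x i, m i - y i) := by
  rw [show 4 * i + 2 = (4 * i + 1) + 1 by ring, pow_succ', Equiv.Perm.mul_apply, h.pow1,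
    Fe_flr (h.ch i).ha]

lemma Orb.pow3 (h : Orb lam p x y m a b c) (i : ℕ) :
    (Fe lam ^ (4 * i + 3)) p = (b i - (m i - y i), a i - x i) := by
  rw [show 4 * i + 3 = (4 * i + 2) + 1 by ring, pow_succ', Equiv.Perm.mul_apply, h.pow2,
    Fe_flr (h.ch i).hb]

lemma Orb.back (h : Orb lam p x y m a b c) (i : ℕ) :
    (Fe lam ^ (-4 : ℤ)) (x (i + 1), y (i + 1)) = (x i, y i) := by
  rw [← h.step, zpow_neg]
  exact Equiv.symm_apply_apply (Fe lam ^ 4) _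

lemma Orb.step1 (h : Orb lam p x y m a b c) (i : ℕ) :
    (Fe lam ^ 4) (m i - y i, x i) = (m (i + 1) - y (i + 1), x (i + 1)) := by
  rw [← h.pow1, ← h.pow1, ← Equiv.Perm.mul_apply, ← pow_add]
  congr 2; ring

lemma Orb.back1 (h : Orb lam p x y m a b c) (i : ℕ) :
    (Fe lam ^ (-4 : ℤ)) (m (i + 1) - y (i + 1), x (i + 1)) = (m i - y i, x i) := by
  rw [← h.step1, zpow_neg]
  exact Equiv.symm_apply_apply (Fe lam ^ 4) _

end

/-- size facts for one step far from the origin -/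
structure SF (lam : ℝ) (M x y m a b c : ℤ) : Prop where
  m0 : 0 ≤ m
  mM : m ≤ M
  ax : a < x
  la : lam * (a : ℝ) < 1
  b1 : b ≤ -1
  bm : b ≤ -m
  bm2 : -m - 2 ≤ b
  ca1 : c - a ≤ 2 * M
  ca2 : -2 * M - 3 ≤ c - a
  low : y ≤ m → 0 ≤ a ∧ c ≤ -1
  high : m < y → 0 ≤ c - a
  high' : 0 ≤ y + b - m → 1 ≤ c - a

lemma step_facts {lam : ℝ} {M x y m a b c : ℤ} (hl : 0 < lam) (hM : 1 ≤ M)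
    (h : Chain lam x y m a b c) (hlM : lam * (8 * M + 40) ≤ 1) (hx : 8 * M + 40 ≤ x)
    (hx2 : lam * (x : ℝ) ≤ M) (hy1 : -((M : ℝ) + 1) ≤ lam * y) (hy2 : lam * (y : ℝ) ≤ M) :
    SF lam M x y m a b c := by
  have hlM' : lam * (8 * M + 40) = 8 * (lam * M) + 40 * lam := by ring
  rw [hlM'] at hlM
  have lM := lmul_le hl hM
  push_cast at lM
  have hx0 := lmul_le hl (show 1 ≤ x by omega)
  push_cast at hx0
  obtain ⟨⟨m1, m2⟩, ⟨a1, a2⟩, ⟨b1, b2⟩, ⟨c1, c2⟩⟩ := h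
  push_cast at *
  have m0 : 0 ≤ m := by apply le_of_lt1; push_cast; linarith
  have mM : m ≤ M := by apply le_of_lt1; linarith
  have lm0 := lmul_le hl m0
  have lmM := lmul_le hl mM
  push_cast at lm0
  have aM : a ≤ M + 1 := by apply le_of_lt1; push_cast; linarith
  have aM2 : -M ≤ a := by apply le_of_lt1; push_cast; linarith
  have lax := lmul_lt hl (show a < x by omega)
  have laM := lmul_le hl aM
  have laM2 := lmul_le hl aM2
  push_cast at laM laM2
  have bb1 : b ≤ -1 := by apply le_of_lt1; push_cast; linarith
  have bbm : b ≤ -m := by apply le_of_lt1; push_cast; linarith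
  have bbm2 : -m - 2 ≤ b := by apply le_of_lt1; push_cast; linarith
  have lb1 := lmul_le hl bb1
  have lb2 := lmul_le hl (show -M - 2 ≤ b by omega)
  push_cast at lb1 lb2
  have cM : c ≤ M := by apply le_of_lt1; linarith
  have cM2 : -M - 2 ≤ c := by apply le_of_lt1; push_cast; linarith
  refine ⟨m0, mM, by omega, by linarith, bb1, bbm, bbm2, by omega, by omega, ?_, ?_, ?_⟩
  · intro hy
    have lym := lmul_le hl hy
    constructor
    · apply le_of_lt1; push_cast; linarith
    · apply le_of_lt1; push_cast; linarith
  · intro hy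
    have lym := lmul_lt hl hy
    have : a ≤ -1 := by apply le_of_lt1; push_cast; linarith
    have : -1 ≤ c := by apply le_of_lt1; push_cast; linarith
    omega
  · intro hy
    have lym := lmul_lt hl (show m < y by omega)
    have ly' := lmul_le hl hy
    push_cast at ly'
    have : a ≤ -1 := by apply le_of_lt1; push_cast; linarith
    have : 0 ≤ c := by apply le_of_lt1; push_cast; linarith
    omega

/-- with `y` bounded by `V`, the rise is at most `2V` -/
lemma rise_bound {lam : ℝ} {V x y m a b c : ℤ} (hl : 0 < lam)
    (h : Chain lam x y m a b c) (m0 : 0 ≤ m) (hb : b ≤ -1) (hy : lam * (y : ℝ) < V) :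
    c - a ≤ 2 * V := by
  obtain ⟨⟨m1, m2⟩, ⟨a1, a2⟩, ⟨b1, b2⟩, ⟨c1, c2⟩⟩ := h
  have lm0 := lmul_le hl m0
  have lb := lmul_le hl hb
  push_cast at *
  have h1 : -V ≤ a := by apply le_of_lt1; push_cast; linarith
  have h2 : c ≤ V := by apply le_of_lt1; linarith
  omega

/-- potentials -/
structure JI (V M x0 y0 x y : ℤ) : Prop where
  yy : y ≤ y0
  lo : x0 ≤ x ∨ (x0 - (2 * M + 4) * (M - y) ≤ x ∧ y ≤ M)
  up : x + (2 * V + 1) * max y 0 ≤ x0 + (2 * V + 1) * y0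

lemma JI_good {lam : ℝ} {V M x0 y0 x y : ℤ} (hl : 0 < lam) (hV : 1 ≤ V)
    (hM : M = V * (2 * V + 2))
    (hlM : lam * (8 * M + 40) ≤ 1) (hx0 : lam * (x0 : ℝ) < V) (hy0 : lam * (y0 : ℝ) < V)
    (hK : (2 * M + 5) * (8 * M + 40) + (2 * M + 4) * (M + 2 * (4 * M + 6)) ≤ x0)
    (hJ : JI V M x0 y0 x y) (hxy : -(2 * (4 * M + 6)) ≤ x + y) :
    8 * M + 40 ≤ x ∧ lam * (x : ℝ) ≤ M ∧ -((M : ℝ) + 1) ≤ lam * y ∧ lam * (y : ℝ) < V ∧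
      lam * (y : ℝ) ≤ M := by
  have hVM : V ≤ M := by nlinarith
  have hM1 : 1 ≤ M := by omega
  have hx : 8 * M + 40 ≤ x := by
    rcases hJ.lo with h | ⟨h, h'⟩
    · nlinarith
    · by_contra hc
      push Not at hc
      nlinarith
  have hxM : lam * (x : ℝ) ≤ M := by
    have h1 : x ≤ x0 + (2 * V + 1) * y0 := by
      have := hJ.up
      have h2 : 0 ≤ (2 * V + 1) * max y 0 := by
        apply mul_nonneg (by omega) (le_max_right _ _)
      omega
    have h2 := lmul_le hl h1
    push_cast at h2
    have hV' : (1:ℝ) ≤ V := by exact_mod_cast hV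
    have h3 : (2 * (V:ℝ) + 1) * (lam * y0) ≤ (2 * V + 1) * V :=
      mul_le_mul_of_nonneg_left hy0.le (by linarith)
    have hM' : (M:ℝ) = V * (2 * V + 2) := by rw [hM]; push_cast; ring
    rw [hM']
    nlinarith
  have hyV : lam * (y : ℝ) < V := lt_of_le_of_lt (lmul_le hl hJ.yy) hy0
  have hVM' : (V : ℝ) ≤ M := by exact_mod_cast hVM
  refine ⟨hx, hxM, ?_, hyV, by linarith⟩
  have h1 := lmul_le hl (show -(8 * M + 12) - x ≤ y by omega)
  push_cast at h1
  nlinarith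

lemma JI_step {V M x0 y0 x y m a b c : ℤ} {lam : ℝ} (hM : 1 ≤ M) (hV : 1 ≤ V)
    (hJ : JI V M x0 y0 x y) (hs : SF lam M x y m a b c) (hr : c - a ≤ 2 * V) :
    JI V M x0 y0 (x + c - a) (y + b - m) := by
  have := hs.b1; have := hs.m0; have := hs.mM; have := hs.ca2
  refine ⟨by have := hJ.yy; omega, ?_, ?_⟩
  · rcases lt_or_ge m y with h | h
    · have := hs.high h
      rcases hJ.lo with h1 | ⟨h1, h2⟩
      · left; omega
      · right
        refine ⟨?_, by omega⟩
        nlinarith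
    · right
      refine ⟨?_, by omega⟩
      rcases hJ.lo with h1 | ⟨h1, h2⟩
      · nlinarith
      · nlinarith
  · have h1 := hJ.up
    rcases lt_or_ge m y with h | h
    · have e1 : max y 0 = y := max_eq_left (by omega)
      rw [e1] at h1
      have h2 : max (y + b - m) 0 ≤ y - 1 := by
        apply max_le <;> omega
      nlinarith
    · have h2 := hs.low h
      have h3 : max (y + b - m) 0 ≤ max y 0 := max_le_max (by omega) le_rfl
      nlinarith

/-- The return time in terms of the orbit under `F^4`. -/
lemma robust_return {lam : ℝ} {p : ℤ × ℤ} {x y m a b c : ℕ → ℤ} {V M : ℤ}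
    (hO : Orb lam p x y m a b c) (hp : p ∈ Xset lam) (hl : 0 < lam) (hV : 1 ≤ V)
    (hM : M = V * (2 * V + 2))
    (hlM : lam * (8 * M + 40) ≤ 1) (hx0 : lam * (x 0 : ℝ) < V) (hy0 : lam * (y 0 : ℝ) < V)
    (hK : (2 * M + 5) * (8 * M + 40) + (2 * M + 4) * (M + 2 * (4 * M + 6)) ≤ x 0) :
    ∃ s : ℕ, 1 ≤ s ∧ tauPlus lam p = 4 * s + 1 ∧ (Fe lam ^ (4 * s + 1)) p ∈ Xset lam ∧
      ∀ i ≤ s + 1, SF lam M (x i) (y i) (m i) (a i) (b i) (c i) ∧ 8 * M + 40 ≤ x i := by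
  have hVM : V ≤ M := by nlinarith
  have hM1 : 1 ≤ M := by omega
  rw [X_iff hl] at hp
  obtain ⟨hp1, hp2, hp3, hp4⟩ := hp
  rw [hO.h0, hO.step] at hp3
  rw [hO.h0] at hp1 hp2
  simp only at hp1 hp2 hp3
  -- the good step
  have good : ∀ i, JI V M (x 0) (y 0) (x i) (y i) → -(2 * (4 * M + 6)) ≤ x i + y i →
      SF lam M (x i) (y i) (m i) (a i) (b i) (c i) ∧ 8 * M + 40 ≤ x i ∧
        JI V M (x 0) (y 0) (x (i + 1)) (y (i + 1)) ∧ -((M : ℝ) + 1) ≤ lam * y i := by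
    intro i hJ hxy
    obtain ⟨g1, g2, g3, g4, g5⟩ := JI_good hl hV hM hlM hx0 hy0 hK hJ hxy
    have sf := step_facts hl hM1 (hO.ch i) hlM g1 g2 g3 g5
    refine ⟨sf, g1, ?_, g3⟩
    rw [hO.sx, hO.sy]
    exact JI_step hM1 hV hJ sf (rise_bound hl (hO.ch i) sf.m0 sf.b1 g4)
  have J0 : JI V M (x 0) (y 0) (x 0) (y 0) := by
    refine ⟨le_rfl, Or.inl le_rfl, ?_⟩
    rw [max_eq_left hp2]
  let U : ℕ → ℤ := fun i => m i - y i - x i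
  have hU : ∀ i, U i = m i - y i - x i := fun i => rfl
  -- while U < 0 everything is good
  have run : ∀ i, (∀ j < i, U j < 0) → JI V M (x 0) (y 0) (x i) (y i) ∧
      -(4 * M + 6) ≤ x i + y i := by
    intro i
    induction i with
    | zero => intro _; exact ⟨J0, by omega⟩
    | succ i ih =>
      intro h
      obtain ⟨h1, h2⟩ := ih (fun j hj => h j (by omega))
      obtain ⟨sf, g1, g2, _⟩ := good i h1 (by omega)
      refine ⟨g2, ?_⟩
      have := h i (by omega)
      rw [hU] at this
      rw [hO.sx, hO.sy]
      have := sf.ca2; have := sf.bm2; have := sf.m0; have := sf.mM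
      omega
  have hex : ∃ i, 0 ≤ U i := by
    by_contra hc
    push Not at hc
    have hy : ∀ i : ℕ, y i ≤ y 0 - i := by
      intro i
      induction i with
      | zero => simp
      | succ i ih =>
        obtain ⟨h1, h2⟩ := run i (fun j _ => hc j)
        obtain ⟨sf, _, _, _⟩ := good i h1 (by omega)
        rw [hO.sy]
        have := sf.b1; have := sf.m0
        push_cast
        omega
    obtain ⟨N, hN⟩ := exists_nat_gt ((lam * y 0 + M + 1) / lam)
    obtain ⟨h1, h2⟩ := run N (fun j _ => hc j)
    obtain ⟨_, _, _, g⟩ := good N h1 (by omega)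
    have h3 := lmul_le hl (hy N)
    push_cast at h3
    rw [div_lt_iff₀ hl] at hN
    linarith
  classical
  let T := Nat.find hex
  have hT : 0 ≤ U T := Nat.find_spec hex
  have hTm : ∀ j < T, U j < 0 := fun j hj => not_le.1 (Nat.find_min hex hj)
  have G : ∀ i ≤ T + 1, SF lam M (x i) (y i) (m i) (a i) (b i) (c i) ∧ 8 * M + 40 ≤ x i := by
    intro i hi
    rcases Nat.lt_or_ge i (T + 1) with h | h
    · obtain ⟨h1, h2⟩ := run i (fun j hj => hTm j (by omega))
      obtain ⟨sf, g1, _⟩ := good i h1 (by omega)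
      exact ⟨sf, g1⟩
    · have : i = T + 1 := by omega
      subst this
      obtain ⟨h1, h2⟩ := run T hTm
      obtain ⟨sf, g1, g2, _⟩ := good T h1 (by omega)
      have : -(2 * (4 * M + 6)) ≤ x (T + 1) + y (T + 1) := by
        rw [hO.sx, hO.sy]
        have := sf.ca2; have := sf.bm2; have := sf.m0; have := sf.mM
        omega
      obtain ⟨sf, g1, _⟩ := good (T + 1) g2 this
      exact ⟨sf, g1⟩
  -- U is increasing below the line y ≤ m
  have Uinc : ∀ i ≤ T, y i ≤ m i → U i < U (i + 1) := by
    intro i hi hy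
    obtain ⟨sf, g⟩ := G i (by omega)
    obtain ⟨sf', g'⟩ := G (i + 1) (by omega)
    have h1 := sf.low hy
    have h2 := sf.b1; have h3 := sf.bm; have h4 := sf.ca2; have h5 := sf.m0
    have hmm : m i - 1 ≤ m (i + 1) := by
      have f1 := (hO.ch i).hm
      have f2 := (hO.ch (i + 1)).hm
      apply le_of_lt1
      have l1 := lmul_le hl (show x i - 2 * M - 3 ≤ x (i + 1) by rw [hO.sx]; omega)
      push_cast at l1
      push_cast
      have lM := lmul_le hl hM1
      push_cast at lM
      nlinarith [f1.1, f2.2]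
    rw [hU, hU, hO.sx, hO.sy]
    omega
  have hT2 : 2 ≤ T := by
    obtain ⟨sf0, g0⟩ := G 0 (by omega)
    by_contra hc
    have hT01 : T = 0 ∨ T = 1 := by omega
    have hm0 := sf0.mM
    rcases hT01 with h | h
    · rw [h, hU] at hT
      omega
    · obtain ⟨sf1, g1⟩ := G 1 (by omega)
      rw [h, hU, show (1:ℕ) = 0 + 1 from rfl, hO.sx, hO.sy] at hT
      have := sf1.mM; have := sf0.ca2; have := sf0.bm2
      simp only [zero_add] at *
      nlinarith
  obtain ⟨t, ht⟩ : ∃ t, T = t + 2 := ⟨T - 2, by omega⟩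
  obtain ⟨sfT, gT⟩ := G T (by omega)
  obtain ⟨sfT1, gT1⟩ := G (t + 1) (by omega)
  obtain ⟨sfT2, gT2⟩ := G t (by omega)
  have yT : y T < 0 := by
    rw [hU] at hT
    have := sfT.mM
    omega
  have yT1 : y (t + 1) < 0 := by
    have h1 := hO.sy (t + 1)
    rw [hU] at hT
    rw [ht] at hT
    have := sfT.mM; have := sfT1.bm2; have := sfT1.mM
    rw [ht] at *
    simp only [add_assoc, Nat.reduceAdd] at *
    omega
  have yT2 : y t < 0 := by
    have h1 := hO.sy (t + 1)
    have h2 := hO.sy t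
    rw [hU] at hT
    rw [ht] at hT
    have := sfT.mM; have := sfT1.bm2; have := sfT1.mM; have := sfT2.bm2; have := sfT2.mM
    rw [ht] at *
    simp only [add_assoc, Nat.reduceAdd] at *
    omega
  have U12 : U t < U (t + 1) := Uinc t (by omega) (by have := sfT2.m0; omega)
  have U23 : U (t + 1) < U (t + 2) := Uinc (t + 1) (by omega) (by have := sfT1.m0; omega)
  have U34 : U T < U (T + 1) := Uinc T le_rfl (by have := sfT.m0; omega)
  have UT1 : U (t + 1) < 0 := hTm _ (by omega)
  -- choose s
  obtain ⟨s, hs1, hsT, hsy, hsU1, hsU2, hsno⟩ : ∃ s : ℕ, 1 ≤ s ∧ s ≤ T ∧ y s < 0 ∧ |U s| ≤ |U (s + 1)| ∧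
      |U s| < |U (s - 1)| ∧ ∀ i < s, y i ≤ m i → |U (i + 1)| < |U i| := by
    have before : ∀ i < t + 1, y i ≤ m i → |U (i + 1)| < |U i| := by
      intro i hi hy
      have h1 := Uinc i (by omega) hy
      have h2 := hTm (i + 1) (by omega)
      rw [abs_of_neg h2, abs_of_neg (by omega)]
      omega
    by_cases hcase : |U (t + 1)| ≤ |U (t + 2)|
    · refine ⟨t + 1, by omega, by omega, yT1, hcase, ?_, before⟩
      simp only [Nat.add_sub_cancel]
      rw [abs_of_neg UT1, abs_of_neg (by omega)]
      omega
    · push Not at hcase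
      refine ⟨t + 2, by omega, by omega, by rw [← ht]; exact yT, ?_, ?_, ?_⟩
      · rw [ht] at hT U34
        rw [abs_of_nonneg hT, abs_of_nonneg (by omega)]
        omega
      · exact hcase
      · intro i hi hy
        rcases Nat.lt_or_ge i (t + 1) with h | h
        · exact before i h hy
        · have : i = t + 1 := by omega
          subst this
          exact hcase
  have hmem : (Fe lam ^ (4 * s + 1)) p ∈ Xset lam := by
    rw [X_iff hl, hO.pow1, hO.step1]
    obtain ⟨s', rfl⟩ : ∃ s', s = s' + 1 := ⟨s - 1, by omega⟩
    rw [hO.back1]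
    obtain ⟨sf, g⟩ := G (s' + 1) (by omega)
    have := sf.m0
    refine ⟨?_, ?_, hsU1, hsU2⟩
    · show 0 ≤ m (s' + 1) - y (s' + 1); omega
    · show 0 ≤ x (s' + 1); omega
  refine ⟨s, hs1, ?_, hmem, fun i hi => G i (by omega)⟩
  -- the minimum
  have uinc : ∀ j, j + 1 ≤ s → 0 ≤ y (j + 1) → |x j - y j| ≤ x (j + 1) - y (j + 1) := by
    intro j
    induction j with
    | zero =>
      intro h1 h2
      obtain ⟨sf, g⟩ := G 0 (by omega)
      have h3 := sf.high' (by rw [← hO.sy]; exact h2)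
      have h4 := sf.b1; have h5 := sf.m0
      have h6 := hO.sx 0
      have h7 := hO.sy 0
      simp only [zero_add] at *
      rcases abs_cases (x 0 - y 0) with ⟨h8, _⟩ | ⟨h8, _⟩ <;>
        rcases abs_cases (x 1 - y 1) with ⟨h9, _⟩ | ⟨h9, _⟩ <;> omega
    | succ j ih =>
      intro h1 h2
      obtain ⟨sf, g⟩ := G (j + 1) (by omega)
      have h3 := sf.high' (by rw [← hO.sy]; exact h2)
      have h4 := sf.b1; have h5 := sf.m0
      have h6 := hO.sx (j + 1)
      have h7 := hO.sy (j + 1)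
      have h8 := ih (by omega) (by omega)
      have h9 := abs_nonneg (x j - y j)
      rw [abs_of_nonneg (by omega)]
      omega
  unfold tauPlus
  apply le_antisymm
  · apply Nat.sInf_le
    refine ⟨by omega, ?_⟩
    rw [zpow_nat_apply]
    exact hmem
  · apply le_csInf
    · exact ⟨4 * s + 1, by omega, by rw [zpow_nat_apply]; exact hmem⟩
    · rintro k ⟨hk1, hk⟩
      by_contra hlt
      push Not at hlt
      rw [zpow_nat_apply] at hk
      obtain ⟨i, hi⟩ : ∃ i, k = 4 * i ∨ k = 4 * i + 1 ∨ k = 4 * i + 2 ∨ k = 4 * i + 3 :=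
        ⟨k / 4, by omega⟩
      rcases hi with rfl | rfl | rfl | rfl
      · obtain ⟨j, rfl⟩ : ∃ j, i = j + 1 := ⟨i - 1, by omega⟩
        rw [X_iff hl, hO.pow, hO.back] at hk
        obtain ⟨_, k2, _, k4⟩ := hk
        simp only at k2 k4
        have := uinc j (by omega) k2
        have := le_abs_self (x (j + 1) - y (j + 1))
        omega
      · rw [X_iff hl, hO.pow1, hO.step1] at hk
        obtain ⟨k1, k2, k3, _⟩ := hk
        have := hsno i (by omega) (by simp only at k1; omega)
        rw [hU, hU] at this
        simp only at k3
        omega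
      · rw [X_iff hl, hO.pow2] at hk
        have := (G i (by omega)).1.ax
        have := hk.1
        simp only at this
        omega
      · rw [X_iff hl, hO.pow3] at hk
        have := (G i (by omega)).1.ax
        have := hk.2.1
        simp only at this
        omega



/-! ### Classification of the non-transition points of `X` -/

lemma sq_le_self_of {m : ℤ} {e : ℕ} (h : m ^ 2 ≤ e) : m ≤ e := by nlinarith

/-- position of a point of `X` in a corner box -/
structure Corner (lam : ℝ) (V x y : ℤ) : Prop where
  V1 : 1 ≤ V
  hx : Flr lam x V
  hy : Flr lam y (V - 1)
  xy1 : y < x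
  xy2 : x - y ≤ 2 * V - 1

set_option maxHeartbeats 2000000 in
lemma classify {lam : ℝ} {e : ℕ} {v x y : ℤ} (hl : 0 < lam) (he : 1 ≤ e)
    (hsm : lam * (100 * ((e : ℝ) + 2) ^ 2) ≤ 1) (hv0 : 0 ≤ v)
    (hv1 : 2 * v ^ 2 ≤ e) (hv2 : (e : ℤ) < 2 * (v + 1) ^ 2)
    (hX : (x, y) ∈ Xset lam) (ht : ¬ IsTransition lam (x, y)) (hI : ham (pt lam (x, y)) ∈ Ie e) :
    0 < x + y ∧ ((Flr lam x v ∧ Flr lam y v ∧ -(2 * v + 1) ≤ x - y ∧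
      Flr lam (x + (2 * v + 1)) v ∧ Flr lam (y - (2 * v + 1)) v ∧
      (Fe lam ^ 4) (x, y) = (x + (2 * v + 1), y - (2 * v + 1))) ∨
    ∃ V, (V = v ∨ V = v + 1) ∧ Corner lam V x y ∧
      (Fe lam ^ (-4 : ℤ)) (x, y) ∈ SigSet lam) := by
  have he1 : (1:ℝ) ≤ e := by exact_mod_cast he
  have hl8 : lam * (8 * e + 8) ≤ 1 := by nlinarith
  have hl1 : lam < 1 := by nlinarith
  rw [X_iff hl] at hX
  obtain ⟨hx0, hy0, h3, h4⟩ := hX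
  simp only at hx0 hy0 h3 h4
  obtain ⟨m, a, b, c, hC⟩ := chain_exists lam x y
  have hyn := flr_floor lam y
  set n := ⌊lam * (y : ℝ)⌋ with hn
  clear_value n
  have lx0 := lmul_le hl hx0
  have ly0 := lmul_le hl hy0
  push_cast at lx0 ly0
  have m0 : 0 ≤ m := by apply le_of_lt1; push_cast; linarith [hC.hm.2]
  have n0 : 0 ≤ n := by apply le_of_lt1; push_cast; linarith [hyn.2]
  obtain ⟨B1, B2⟩ := ham_pos_bounds hC.hm hyn m0 n0 hI
  have me : m ≤ e := by nlinarith
  have ne : n ≤ e := by nlinarith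
  have lm0 := lmul_le hl m0
  have ln0 := lmul_le hl n0
  have lme := lmul_le hl me
  have lne := lmul_le hl ne
  push_cast at lm0 ln0 lme lne
  have hxy : 0 < x + y := by
    by_contra hc
    have hx : x = 0 := by omega
    have hy : y = 0 := by omega
    subst hx hy
    have h1 := hI.1
    rw [ham_expand hC.hm hyn] at h1
    have : m = 0 := by have := hC.hm.1; push_cast at this; have : m ≤ 0 := by (apply le_of_lt1; push_cast; linarith)
                       omega
    have : n = 0 := by have := hyn.1; push_cast at this; have : n ≤ 0 := by (apply le_of_lt1; push_cast; linarith)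
                       omega
    subst m n
    push_cast at h1
    nlinarith
  refine ⟨hxy, ?_⟩
  obtain ⟨_, a0, ax, la⟩ := nonneg_core hl hl1 hC hx0 hy0 hxy (by nlinarith)
  obtain ⟨_, _, _, hF, hx', hy'⟩ := nontrans_step hl hC hyn m0 ax la ht
  rw [hF] at h3
  simp only at h3
  have u1 : -(m + n + 1) ≤ x - y := by
    rcases abs_cases (x - y) with ⟨k, _⟩ | ⟨k, _⟩ <;>
    rcases abs_cases (x + (2 * n + 1) - (y - (2 * m + 1))) with ⟨k', _⟩ | ⟨k', _⟩ <;> omega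
  -- m = n case
  have same : m = n → (Flr lam x v ∧ Flr lam y v ∧ -(2 * v + 1) ≤ x - y ∧
      Flr lam (x + (2 * v + 1)) v ∧ Flr lam (y - (2 * v + 1)) v ∧
      (Fe lam ^ 4) (x, y) = (x + (2 * v + 1), y - (2 * v + 1))) := by
    intro h
    subst h
    have : m = v := by
      apply le_antisymm
      · by_contra hc
        have : v + 1 ≤ m := by omega
        nlinarith
      · by_contra hc
        have : m + 1 ≤ v := by omega
        nlinarith
    subst this
    exact ⟨hC.hm, hyn, by omega, hx', hy', hF⟩
  by_cases hmn : m = n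
  · left; exact same hmn
  right
  obtain ⟨m1, m2, m3, m4, hI4⟩ := ichain_exists lam x y
  have hB := hI4.F4
  rw [hB] at h4
  simp only at h4
  obtain ⟨i1, ⟨i2, i2'⟩, ⟨i3, i3'⟩, ⟨i4, i4'⟩⟩ := hI4
  obtain ⟨mm1, mm2⟩ := hC.hm
  obtain ⟨y1, y2⟩ := hyn
  have : m1 = n := flr_unique i1 ⟨y1, y2⟩
  subst this
  push_cast at *
  have m2a : m2 ≤ -m := by apply le_of_lt1; push_cast; linarith
  have m2b : -m - 1 ≤ m2 := by apply le_of_lt1; push_cast; linarith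
  have lm2 := lmul_le hl m2a
  have lm2' := lmul_le hl m2b
  push_cast at lm2 lm2'
  have m3a : m3 ≤ -m1 := by apply le_of_lt1; push_cast; linarith
  have m3b : -m1 - 2 ≤ m3 := by apply le_of_lt1; push_cast; linarith
  have lm3 := lmul_le hl m3a
  have lm3' := lmul_le hl m3b
  push_cast at lm3 lm3'
  have m4a : m4 ≤ m := by apply le_of_lt1; push_cast; linarith
  have m4b : m - 1 ≤ m4 := by apply le_of_lt1; push_cast; linarith
  have hD : 2 * (x - y) < m1 - m3 + m4 - m2 := by
    rcases abs_cases (x - y) with ⟨k, _⟩ | ⟨k, _⟩ <;>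
    rcases abs_cases (x + m3 - m1 - (y + m4 - m2)) with ⟨k', _⟩ | ⟨k', _⟩ <;> omega
  have u2 : x - y ≤ m + m1 + 1 := by omega
  have lu1 := lmul_le hl u1
  have lu2 := lmul_le hl u2
  push_cast at lu1 lu2
  have c1 : m1 ≤ m + 1 := by apply le_of_lt1; push_cast; linarith
  have c2 : m ≤ m1 + 1 := by apply le_of_lt1; push_cast; linarith
  have hcase : m1 = m + 1 ∨ m = m1 + 1 := by omega
  rcases hcase with h | h
  · -- n = m + 1
    exfalso
    have hlt : x + (2 * m1 + 1) < y - (2 * m + 1) := by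
      apply of_lmul_lt hl
      have k1 := hx'.2
      have k2 := hy'.1
      rw [h] at k2
      push_cast at *
      rw [h] at *
      push_cast at *
      linarith
    omega
  · -- m = n + 1
    have hn1 : m1 = m - 1 := by omega
    subst hn1
    push_cast at *
    have u0 : y < x := by apply of_lmul_lt hl; linarith
    have m3c : m3 ≤ -m := by apply le_of_lt1; push_cast; nlinarith
    have u3 : x - y ≤ 2 * m - 1 := by
      by_contra hc
      have q1 : x - y = 2 * m := by omega
      have q2 : m3 = -m - 1 := by omega
      have q3 : m4 = m := by omega
      subst q2 q3
      have := lmul_le hl (show x - 2 * m4 ≤ y by omega)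
      push_cast at *
      linarith
    have lu3 := lmul_le hl u3
    push_cast at lu3
    refine ⟨m, ?_, ⟨by omega, ⟨mm1, mm2⟩, ⟨by push_cast; linarith, by push_cast; linarith⟩, u0, u3⟩, ?_⟩
    · have : v ≤ m := by
        by_contra hc
        have : m + 1 ≤ v := by omega
        nlinarith
      have : m ≤ v + 1 := by
        by_contra hc
        have : v + 2 ≤ m := by omega
        nlinarith
      omega
    · have ly' := lmul_le hl (show y + (2 * m - 1) ≤ y + m4 - m2 by omega)
      have ly'' := lmul_le hl (show y + m4 - m2 ≤ y + (2 * m + 1) by omega)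
      have lx' := lmul_le hl (show x + m3 - (m - 1) ≤ x - (2 * m - 1) by omega)
      have lx'' := lmul_le hl (show x - 2 * m ≤ x + m3 - (m - 1) by omega)
      push_cast at ly' ly'' lx' lx''
      have hB' : (Fe lam ^ 4) (x + m3 - (m - 1), y + m4 - m2) = (x, y) := by
        rw [← hB, zpow_neg]
        exact Equiv.apply_symm_apply (Fe lam ^ 4) _
      rw [hB]
      by_contra hs
      have htr : IsTransition lam (x + m3 - (m - 1), y + m4 - m2) := by
        unfold IsTransition
        rw [hB', Rmap_iff.2 ⟨⟨mm1, mm2⟩, (⟨by push_cast; linarith, by push_cast; linarith⟩ : Flr lam y (m - 1))⟩]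
        intro hR
        have hR2 := (Rmap_iff.1 hR.symm).2.2
        push_cast at hR2
        linarith
      refine not_sig' hl hs htr m m (2 * m + 3) (Or.inl ?_) ?_ ?_ ?_ ?_
      · have := le_abs_self (2 * m + 1); omega
      all_goals push_cast; nlinarith

/-- diagonal points are in `X` -/
lemma diag_mem_X {lam : ℝ} {M v : ℤ} (hl : 0 < lam) (hv : 0 ≤ v) (hM : Flr lam M v)
    (hvl : lam * ((v : ℝ) + 2) < 1) (hMv : 2 * v + 3 ≤ M) : (M, M) ∈ Xset lam := by
  rw [X_iff hl]
  refine ⟨by simp only; omega, by simp only; omega, by simp, ?_⟩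
  obtain ⟨m1, m2, m3, m4, hI4⟩ := ichain_exists lam M M
  have hB := hI4.F4
  rw [hB]
  obtain ⟨i1, ⟨i2, i2'⟩, ⟨i3, i3'⟩, ⟨i4, i4'⟩⟩ := hI4
  have : m1 = v := flr_unique i1 hM
  subst this
  obtain ⟨M1, M2⟩ := hM
  push_cast at *
  have l1 := lmul_lt hl (show m1 < M by omega)
  have l0 := lmul_le hl hv
  push_cast at l0
  have m2a : m2 ≤ -1 := by apply le_of_lt1; push_cast; linarith
  have m2b : -m1 - 1 ≤ m2 := by apply le_of_lt1; push_cast; linarith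
  have lm2 := lmul_le hl m2a
  have lm2' := lmul_le hl m2b
  push_cast at lm2 lm2'
  have m3a : m3 ≤ -1 := by apply le_of_lt1; push_cast; linarith
  have m3b : -m1 - 2 ≤ m3 := by apply le_of_lt1; push_cast; linarith
  have l4 := lmul_le hl (show 0 ≤ m3 - m1 + M by omega)
  push_cast at l4
  have m4a : 0 ≤ m4 := by apply le_of_lt1; push_cast; linarith
  simp only [sub_self, abs_zero, abs_pos]
  omega

lemma corner_ham {lam : ℝ} {V x y : ℤ} (h : Corner lam V x y) :
    ham (pt lam (x, y)) = 2 * (V:ℝ) ^ 2 + (2 * V + 1) * (lam * x - V) + (2 * V - 1) * (lam * y - V) := by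
  rw [ham_box h.hx h.hy]; push_cast; ring

lemma lower_contra {lam : ℝ} {e : ℕ} {I : Set ℝ} {v x y N : ℤ} {r : ℝ} (hl : 0 < lam)
    (hI : I.OrdConnected)
    (hreg : ∀ p ∈ Xset lam, ham (pt lam p) ∈ I → RegularPt lam e p)
    (hsm : lam * (10 * (v:ℝ) + 10) ≤ 1)
    (hc : Corner lam v x y) (hp : ham (pt lam (x, y)) ∈ I)
    (hN1 : (v : ℝ) ≤ lam * N) (hN2 : lam * (N:ℝ) - lam < v)
    (hr : r ∈ I) (hrq : 2 * (v:ℝ)^2 + 2 * (2 * v + 1) * (lam * N + lam * v - v) ≤ r) : False := by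
  have hv1 := hc.V1
  have lv1 := lmul_le hl hv1
  push_cast at lv1
  have hv1' : (1:ℝ) ≤ v := by exact_mod_cast hv1
  have hq : Flr lam (N + v) v := by
    constructor <;> push_cast <;> nlinarith
  have hNv : 2 * v + 3 ≤ N := by
    apply of_lmul_le hl
    push_cast
    nlinarith
  have hqX : (N + v, N + v) ∈ Xset lam :=
    diag_mem_X hl (by omega) hq (by nlinarith) (by omega)
  have hqham : ham (pt lam (N + v, N + v)) =
      2 * (v:ℝ)^2 + 2 * (2 * v + 1) * (lam * N + lam * v - v) := by
    rw [ham_box hq hq]; push_cast; ring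
  have hxu : x ≤ N + 2 * v - 2 := by
    have h1 : y < N := by
      apply of_lmul_lt hl
      have := hc.hy.2
      push_cast at this
      linarith
    have := hc.xy2
    omega
  have hpq : ham (pt lam (x, y)) ≤ ham (pt lam (N + v, N + v)) := by
    rw [hqham, corner_ham hc]
    have h1 := lmul_le hl hxu
    have h2 := hc.hy.2
    push_cast at h1 h2
    have h3 : (2 * (v:ℝ) + 1) * (lam * x - v) ≤ (2 * v + 1) * (lam * N + 2 * (lam * v) - 2 * lam - v) :=
      mul_le_mul_of_nonneg_left (by linarith) (by linarith)
    have h4 : (2 * (v:ℝ) - 1) * (lam * y - v) ≤ 0 :=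
      mul_nonpos_of_nonneg_of_nonpos (by linarith) (by linarith)
    have h5 : 0 ≤ (2 * (v:ℝ) + 1) * (lam * N - v) := mul_nonneg (by linarith) (by linarith)
    nlinarith
  have hqI : ham (pt lam (N + v, N + v)) ∈ I := hI.out hp hr ⟨hpq, by rw [hqham]; exact hrq⟩
  obtain ⟨_, _, _, _, _, hS⟩ := hreg _ hqX hqI
  have hS0 := hS 0 (Nat.zero_le _)
  simp only [Nat.cast_zero, zpow_zero, Equiv.Perm.coe_one, id] at hS0
  have htr : IsTransition lam (N + v, N + v) := by
    by_contra ht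
    obtain ⟨m, a, b, c, hC⟩ := chain_exists lam (N + v) (N + v)
    have hm : m = v := flr_unique hC.hm hq
    subst hm
    obtain ⟨_, _, ax, la⟩ := nonneg_core hl (by nlinarith) hC (by omega) (by omega) (by omega) (by nlinarith)
    obtain ⟨_, _, _, _, _, hy'⟩ := nontrans_step hl hC hq (by omega) ax la ht
    have := hy'.1
    push_cast at this
    nlinarith
  refine not_sig' hl hS0 htr v v (2 * v + 3) (Or.inl ?_) ?_ ?_ ?_ ?_
  · have := le_abs_self (2 * v + 1); omega
  all_goals push_cast; nlinarith

lemma upper_contra {lam : ℝ} {e : ℕ} {I : Set ℝ} {V x y N : ℤ} {r : ℝ} (hl : 0 < lam)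
    (hI : I.OrdConnected)
    (hreg : ∀ p ∈ Xset lam, ham (pt lam p) ∈ I → RegularPt lam e p)
    (hsm : lam * (10 * (V:ℝ) + 10) ≤ 1)
    (hc : Corner lam V x y) (hp : ham (pt lam (x, y)) ∈ I)
    (hN1 : (V : ℝ) ≤ lam * N) (hN2 : lam * (N:ℝ) - lam < V)
    (hr : r ∈ I) (hrq : r ≤ 2 * (V:ℝ)^2 + 2 * (2 * V - 1) * (lam * N - lam * V - V)) : False := by
  have hv1 := hc.V1
  have lv1 := lmul_le hl hv1
  push_cast at lv1
  have hv1' : (1:ℝ) ≤ V := by exact_mod_cast hv1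
  have hq : Flr lam (N - V) (V - 1) := by
    constructor <;> push_cast <;> nlinarith
  have hNv : 3 * V + 3 ≤ N := by
    apply of_lmul_le hl
    push_cast
    nlinarith
  have hqX : (N - V, N - V) ∈ Xset lam :=
    diag_mem_X hl (by omega) hq (by push_cast; nlinarith) (by omega)
  have hqham : ham (pt lam (N - V, N - V)) =
      2 * (V:ℝ)^2 + 2 * (2 * V - 1) * (lam * N - lam * V - V) := by
    rw [ham_box hq hq]; push_cast; ring
  have hxN : N ≤ x := by
    have : N - 1 < x := by
      apply of_lmul_lt hl
      have := hc.hx.1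
      push_cast
      linarith
    omega
  have hpq : ham (pt lam (N - V, N - V)) ≤ ham (pt lam (x, y)) := by
    rw [hqham, corner_ham hc]
    have h1 := lmul_le hl hxN
    have h2 := lmul_le hl (show N - (2 * V - 1) ≤ y by have := hc.xy2; omega)
    push_cast at h1 h2
    have h3 : (2 * (V:ℝ) + 1) * (lam * N - V) ≤ (2 * V + 1) * (lam * x - V) :=
      mul_le_mul_of_nonneg_left (by linarith) (by linarith)
    have h4 : (2 * (V:ℝ) - 1) * (lam * N - 2 * (lam * V) + lam - V) ≤ (2 * (V:ℝ) - 1) * (lam * y - V) :=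
      mul_le_mul_of_nonneg_left (by linarith) (by linarith)
    have h5 : 0 ≤ (2 * (V:ℝ) + 1) * (lam * N - V) := mul_nonneg (by linarith) (by linarith)
    nlinarith
  have hqI : ham (pt lam (N - V, N - V)) ∈ I := hI.out hr hp ⟨by rw [hqham]; exact hrq, hpq⟩
  obtain ⟨_, _, _, _, _, hS⟩ := hreg _ hqX hqI
  have hS0 := hS 0 (Nat.zero_le _)
  simp only [Nat.cast_zero, zpow_zero, Equiv.Perm.coe_one, id] at hS0
  have htr : IsTransition lam (N - V, N - V) := by
    by_contra ht
    obtain ⟨m, a, b, c, hC⟩ := chain_exists lam (N - V) (N - V)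
    have hm : m = V - 1 := flr_unique hC.hm hq
    subst hm
    obtain ⟨_, _, ax, la⟩ := nonneg_core hl (by nlinarith) hC (by omega) (by omega) (by omega) (by push_cast; nlinarith)
    obtain ⟨_, _, _, _, hx', _⟩ := nontrans_step hl hC hq (by omega) ax la ht
    have := hx'.2
    push_cast at this
    nlinarith
  refine not_sig' hl hS0 htr V V (2 * V + 3) (Or.inl ?_) ?_ ?_ ?_ ?_
  · have := le_abs_self (2 * V + 1); omega
  all_goals push_cast; nlinarith



/-- a point of `X` in the box `(v,v)` -/
structure Boxed (lam : ℝ) (v x y : ℤ) : Prop where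
  hx : Flr lam x v
  hy : Flr lam y v
  u : -(2 * v + 1) ≤ x - y
  hx' : Flr lam (x + (2 * v + 1)) v
  hy' : Flr lam (y - (2 * v + 1)) v
  hF : (Fe lam ^ 4) (x, y) = (x + (2 * v + 1), y - (2 * v + 1))

lemma exists_N {lam : ℝ} (hl : 0 < lam) (V : ℤ) :
    ∃ N : ℤ, (V : ℝ) ≤ lam * N ∧ lam * (N:ℝ) - lam < V := by
  refine ⟨⌈(V:ℝ) / lam⌉, ?_, ?_⟩
  · have := Int.le_ceil ((V:ℝ) / lam)
    rw [div_le_iff₀ hl] at this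
    linarith
  · have := Int.ceil_lt_add_one ((V:ℝ) / lam)
    have h2 : lam * (⌈(V:ℝ) / lam⌉ : ℝ) < lam * ((V:ℝ) / lam + 1) := mul_lt_mul_of_pos_left this hl
    have h3 : lam * ((V:ℝ) / lam + 1) = V + lam := by field_simp
    linarith

lemma mixed_lower {lam : ℝ} {e : ℕ} {I : Set ℝ} {v x y x' y' : ℤ} (hl : 0 < lam)
    (hI : I.OrdConnected)
    (hreg : ∀ p ∈ Xset lam, ham (pt lam p) ∈ I → RegularPt lam e p)
    (hsm : lam * (10 * (v:ℝ) + 10) ≤ 1)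
    (hc : Corner lam v x y) (hp : ham (pt lam (x, y)) ∈ I)
    (hb : Boxed lam v x' y') (hp' : ham (pt lam (x', y')) ∈ I) : False := by
  obtain ⟨N, hN1, hN2⟩ := exists_N hl v
  refine lower_contra hl hI hreg hsm hc hp hN1 hN2 hp' ?_
  have hv : (1:ℝ) ≤ v := by exact_mod_cast hc.V1
  rw [ham_box hb.hx hb.hy]
  have h1 : N ≤ x' := by
    have : N - 1 < x' := by
      apply of_lmul_lt hl
      have := hb.hx.1
      push_cast; linarith
    omega
  have h2 : N ≤ y' - (2 * v + 1) := by
    have : N - 1 < y' - (2 * v + 1) := by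
      apply of_lmul_lt hl
      have := hb.hy'.1
      push_cast at *; linarith
    omega
  have l1 := lmul_le hl h1
  have l2 := lmul_le hl h2
  push_cast at l2
  have h3 : 0 ≤ (2 * (v:ℝ) + 1) * (lam * x' + lam * y' - 2 * (lam * N) - 2 * (lam * v)) :=
    mul_nonneg (by linarith) (by linarith)
  linarith

lemma mixed_upper {lam : ℝ} {e : ℕ} {I : Set ℝ} {v x y x' y' : ℤ} (hl : 0 < lam)
    (hI : I.OrdConnected)
    (hreg : ∀ p ∈ Xset lam, ham (pt lam p) ∈ I → RegularPt lam e p)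
    (hsm : lam * (10 * (v:ℝ) + 20) ≤ 1)
    (hc : Corner lam (v + 1) x y) (hp : ham (pt lam (x, y)) ∈ I)
    (hb : Boxed lam v x' y') (hp' : ham (pt lam (x', y')) ∈ I) : False := by
  obtain ⟨N, hN1, hN2⟩ := exists_N hl (v + 1)
  refine upper_contra hl hI hreg (by push_cast; linarith) hc hp hN1 hN2 hp' ?_
  have hv0 : (1:ℤ) ≤ v + 1 := hc.V1
  have hv : (0:ℝ) ≤ v := by exact_mod_cast (by omega : 0 ≤ v)
  rw [ham_box hb.hx hb.hy]
  push_cast at hN1 hN2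
  have h1 : y' ≤ N - 1 := by
    have : y' < N := by
      apply of_lmul_lt hl
      have := hb.hy.2
      linarith
    omega
  have h2 : x' + (2 * v + 1) ≤ N - 1 := by
    have : x' + (2 * v + 1) < N := by
      apply of_lmul_lt hl
      have := hb.hx'.2
      linarith
    omega
  have l1 := lmul_le hl h1
  have l2 := lmul_le hl h2
  push_cast at l1 l2
  have h3 : 0 ≤ (2 * (v:ℝ) + 1) * (2 * (lam * N) - 2 * (lam * v) - 2 * lam - lam * x' - lam * y') :=
    mul_nonneg (by linarith) (by linarith)
  push_cast
  linarith

lemma mixed_corners {lam : ℝ} {e : ℕ} {I : Set ℝ} {v x y x' y' : ℤ} (hl : 0 < lam)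
    (hI : I.OrdConnected)
    (hreg : ∀ p ∈ Xset lam, ham (pt lam p) ∈ I → RegularPt lam e p)
    (hsm : lam * (100 * ((v:ℝ) + 1) ^ 2) ≤ 1)
    (hc : Corner lam v x y) (hp : ham (pt lam (x, y)) ∈ I)
    (hc' : Corner lam (v + 1) x' y') (hp' : ham (pt lam (x', y')) ∈ I) : False := by
  obtain ⟨N, hN1, hN2⟩ := exists_N hl v
  have hv : (1:ℝ) ≤ v := by exact_mod_cast hc.V1
  refine lower_contra hl hI hreg (by nlinarith) hc hp hN1 hN2 hp' ?_
  rw [corner_ham hc']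
  have h1 := hc'.hx.1
  have h2 := lmul_le hl (show x' - (2 * (v + 1) - 1) ≤ y' by have := hc'.xy2; omega)
  push_cast at h1 h2 ⊢
  have h3 : 0 ≤ (2 * ((v:ℝ) + 1) + 1) * (lam * x' - (v + 1)) :=
    mul_nonneg (by linarith) (by linarith)
  have h4 : (2 * ((v:ℝ) + 1) - 1) * (-(2 * (lam * v) + lam)) ≤ (2 * ((v:ℝ) + 1) - 1) * (lam * y' - (v + 1)) :=
    mul_le_mul_of_nonneg_left (by linarith) (by linarith)
  have h5 : 2 * (2 * (v:ℝ) + 1) * (lam * N + lam * v - v) ≤ 2 * (2 * v + 1) * (lam * v + lam) :=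
    mul_le_mul_of_nonneg_left (by linarith) (by linarith)
  nlinarith

lemma zero_of_dvd_small {h d : ℤ} (hd : h ∣ d) (h1 : d < h) (h2 : -h < d) : d = 0 :=
  Int.eq_zero_of_abs_lt_dvd hd (abs_lt.2 ⟨by omega, by omega⟩)

lemma same_corner {lam : ℝ} {v V x y x' y' : ℤ} (hl : 0 < lam) (hV : V = v ∨ V = v + 1)
    (hc : Corner lam V x y) (hc' : Corner lam V x' y') (hx : 2 * v + 1 ∣ x' - x)
    (hy : 2 * v + 1 ∣ y' - y) : x' = x ∧ y' = y := by
  have key : ∀ {x y x' y' : ℤ}, Corner lam V x y → Corner lam V x' y' →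
      y < x' := by
    intro x y x' y' h h'
    apply of_lmul_lt hl
    have h1 := h.hy.2
    have h2 := h'.hx.1
    push_cast at h1
    linarith
  have k1 := key hc hc'
  have k2 := key hc' hc
  have k3 := hc.xy2
  have k4 := hc'.xy2
  have a1 := zero_of_dvd_small hx (by omega) (by omega)
  have a2 := zero_of_dvd_small hy (by omega) (by omega)
  omega

lemma start_boxed {lam : ℝ} {e : ℕ} {I : Set ℝ} {v x y x' y' : ℤ} (hl : 0 < lam) (he : 1 ≤ e)
    (hsm : lam * (100 * ((e : ℝ) + 2) ^ 2) ≤ 1) (hv0 : 0 ≤ v)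
    (hv1 : 2 * v ^ 2 ≤ e) (hv2 : (e : ℤ) < 2 * (v + 1) ^ 2)
    (hI : I.OrdConnected)
    (hreg : ∀ p ∈ Xset lam, ham (pt lam p) ∈ I → RegularPt lam e p)
    (hX : (x, y) ∈ Xset lam) (hp : ham (pt lam (x, y)) ∈ I)
    (hX' : (x', y') ∈ Xset lam) (hp' : ham (pt lam (x', y')) ∈ I)
    (hdx : 2 * v + 1 ∣ x' - x) (hdy : 2 * v + 1 ∣ y' - y) :
    (x' = x ∧ y' = y) ∨ (Boxed lam v x y ∧ Boxed lam v x' y') := by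
  obtain ⟨_, r1, r2, r3, _⟩ := hreg _ hX hp
  obtain ⟨_, s1, s2, s3, _⟩ := hreg _ hX' hp'
  have hve : v ≤ e := by nlinarith
  have hve' : (v:ℝ) ≤ e := by exact_mod_cast hve
  have hv0' : (0:ℝ) ≤ v := by exact_mod_cast hv0
  have hsm1 : lam * (100 * ((v:ℝ) + 1) ^ 2) ≤ 1 := by
    refine le_trans (mul_le_mul_of_nonneg_left ?_ hl.le) hsm
    nlinarith
  have hsm2 : lam * (10 * (v:ℝ) + 20) ≤ 1 := by
    refine le_trans (mul_le_mul_of_nonneg_left ?_ hl.le) hsm1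
    nlinarith
  have hsm3 : lam * (10 * (v:ℝ) + 10) ≤ 1 := by nlinarith
  obtain ⟨_, c1⟩ := classify hl he hsm hv0 hv1 hv2 hX r2 r1
  obtain ⟨_, c2⟩ := classify hl he hsm hv0 hv1 hv2 hX' s2 s1
  rcases c1 with ⟨b1, b2, b3, b4, b5, b6⟩ | ⟨V, hV, hc, _⟩ <;>
  rcases c2 with ⟨b1', b2', b3', b4', b5', b6'⟩ | ⟨V', hV', hc', _⟩
  · right; exact ⟨⟨b1, b2, b3, b4, b5, b6⟩, ⟨b1', b2', b3', b4', b5', b6'⟩⟩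
  · exfalso
    rcases hV' with rfl | rfl
    · exact mixed_lower hl hI hreg hsm3 hc' hp' ⟨b1, b2, b3, b4, b5, b6⟩ hp
    · exact mixed_upper hl hI hreg hsm2 hc' hp' ⟨b1, b2, b3, b4, b5, b6⟩ hp
  · exfalso
    rcases hV with rfl | rfl
    · exact mixed_lower hl hI hreg hsm3 hc hp ⟨b1', b2', b3', b4', b5', b6'⟩ hp'
    · exact mixed_upper hl hI hreg hsm2 hc hp ⟨b1', b2', b3', b4', b5', b6'⟩ hp'
  · left
    rcases hV with rfl | rfl <;> rcases hV' with rfl | rfl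
    · exact same_corner hl (Or.inl rfl) hc hc' hdx hdy
    · exact (mixed_corners hl hI hreg hsm1 hc hp hc' hp').elim
    · exact (mixed_corners hl hI hreg hsm1 hc' hp' hc hp).elim
    · exact same_corner hl (Or.inr rfl) hc hc' hdx hdy



/-! ### The local structure of a step of the orbit -/

/-- one step of `F^4` along a regular orbit: between boxes -/
def StepR (lam : ℝ) (e : ℕ) (x y m n x' y' m' n' : ℤ) : Prop :=
  (m' = m ∧ n' = n ∧ x' = x + (2 * n + 1) ∧ y' = y - (2 * m + 1)) ∨
  (m' = m ∧ n' = n - 1 ∧ y' = y - (2 * m + 1) ∧ (∃ a, Flr lam (m - y) a ∧ x' = x + (n - 1) - a) ∧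
    m ^ 2 + n ^ 2 ≤ (e : ℤ) ∧ (e : ℤ) < (m + 1) ^ 2 + n ^ 2) ∨
  (n' = n ∧ x' = x + (2 * n + 1) ∧ (∃ b, Flr lam (-n - 1 - x) b ∧ y' = y + b - m) ∧
    ((0 ≤ n ∧ m' = m + 1 ∧ (m + 1) ^ 2 + n ^ 2 ≤ (e : ℤ) ∧ (e : ℤ) < (m + 1) ^ 2 + (n + 1) ^ 2) ∨
     (n < 0 ∧ m' = m - 1 ∧ (e : ℤ) < m ^ 2 + n ^ 2 ∧ m ^ 2 + (n + 1) ^ 2 ≤ (e : ℤ))))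

set_option maxHeartbeats 2000000 in
lemma step_lemma {lam : ℝ} {e : ℕ} {x y m n a b c x' y' m' n' : ℤ} (hl : 0 < lam)
    (hsm : lam * (20 * (e : ℝ) + 40) ≤ 1)
    (hC : Chain lam x y m a b c) (hy : Flr lam y n) (m0 : 0 ≤ m) (ax : a < x)
    (la : lam * (a : ℝ) < 1) (hI : ham (pt lam (x, y)) ∈ Ie e) (hs : (x, y) ∉ SigSet lam)
    (n1 : -m - 1 ≤ n) (n2 : n ≤ m)
    (hx' : x' = x + c - a) (hy' : y' = y + b - m) (hm' : Flr lam x' m') (hn' : Flr lam y' n') :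
    StepR lam e x y m n x' y' m' n' := by
  have me : m ≤ e := by
    rcases le_or_gt 0 n with h | h
    · have := ham_pos_bounds hC.hm hy m0 h hI; nlinarith
    · have := ham_neg_bounds hC.hm hy m0 h hI; nlinarith
  by_cases ht : IsTransition lam (x, y)
  swap
  · left
    obtain ⟨h1, h2, h3, h4, h5, h6⟩ := nontrans_step hl hC hy m0 ax la ht
    subst h1 h2 h3
    have e1 : x' = x + (2 * c + 1) := by omega
    have e2 : y' = y - (2 * m + 1) := by omega
    subst e1 e2
    exact ⟨flr_unique hm' h5, flr_unique hn' h6, rfl, rfl⟩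
  right
  have hcn : n' = c := by subst hy'; exact flr_unique hn' hC.hc
  subst hcn
  have htr := ht
  unfold IsTransition at htr
  rw [hC.F4, ← hx', ← hy', Rmap_iff.2 ⟨hm', hn'⟩, Rmap_iff.2 ⟨hC.hm, hy⟩] at htr
  have lm0 := lmul_le hl m0
  have lme := lmul_le hl me
  have ln1 := lmul_le hl n1
  have ln2 := lmul_le hl n2
  have lax := lmul_lt hl ax
  obtain ⟨⟨mm1, mm2⟩, ⟨a1, a2⟩, ⟨b1, b2⟩, ⟨c1, c2⟩⟩ := hC
  have hy0 := hy
  obtain ⟨y1, y2⟩ := hy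
  push_cast at *
  have ha1 : a ≤ -n := by apply le_of_lt1; push_cast; nlinarith
  have ha2 : -n - 1 ≤ a := by apply le_of_lt1; push_cast; nlinarith
  have lam1 := lmul_le hl ha1
  have lam2 := lmul_le hl ha2
  push_cast at lam1 lam2
  have hb1 : b ≤ -m := by apply le_of_lt1; push_cast; linarith
  have hb0 : b ≤ -1 := by apply le_of_lt1; push_cast; linarith
  have hb2 : -m - 2 ≤ b := by apply le_of_lt1; push_cast; nlinarith
  have lb0 := lmul_le hl hb0
  have lb2 := lmul_le hl hb2
  push_cast at lb0 lb2
  have hc1 : n' ≤ n := by apply le_of_lt1; linarith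
  have hc2 : n - 1 ≤ n' := by apply le_of_lt1; push_cast; nlinarith
  have m0' : (0:ℝ) ≤ m := by exact_mod_cast m0
  have n1' : -(m:ℝ) - 1 ≤ n := by exact_mod_cast n1
  have n2' : (n:ℝ) ≤ m := by exact_mod_cast n2
  rcases (by omega : n' = n - 1 ∨ n' = n) with hc | hc
  · -- Y crossing
    left
    subst hc
    push_cast at *
    have ylow : lam * y - n < lam * (2 * m + 2) := by nlinarith
    have sx1 : m + lam * (2 * m + 3) < lam * x := by
      by_contra hcon
      push Not at hcon
      refine not_sig' hl hs ht m n (2 * m + 3) (Or.inr ?_) ?_ ?_ ?_ ?_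
      · have := le_abs_self (2 * m + 1); omega
      all_goals push_cast; nlinarith
    have sx2 : lam * x < m + 1 - lam * (2 * m + 5) := by
      by_contra hcon
      push Not at hcon
      refine not_sig' hl hs ht (m + 1) n (2 * m + 5) (Or.inr ?_) ?_ ?_ ?_ ?_
      · have := le_abs_self (2 * (m + 1) + 1); omega
      all_goals push_cast; nlinarith
    have hb : b = -m - 1 := by
      apply le_antisymm <;> apply le_of_lt1 <;> push_cast <;> nlinarith
    subst hb
    have hmm : m' = m := by
      apply flr_unique hm'
      constructor <;> push_cast [hx'] <;> nlinarith
    refine ⟨hmm, rfl, by omega, ⟨a, ⟨by push_cast; linarith, by push_cast; linarith⟩, by omega⟩, ?_⟩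
    rcases le_or_gt 0 n with h | h
    · obtain ⟨p1, p2⟩ := ham_pos_bounds ⟨mm1, mm2⟩ hy0 m0 h hI
      refine ⟨p1, ?_⟩
      have h1 := hI.1
      rw [ham_box ⟨mm1, mm2⟩ hy0] at h1
      have h' : (0:ℝ) ≤ n := by exact_mod_cast h
      have q1 : (2 * (m:ℝ) + 1) * (lam * x - m) ≤ (2 * m + 1) * (1 - lam * (2 * m + 5)) :=
        mul_le_mul_of_nonneg_left (by linarith) (by linarith)
      have q2 : (2 * (n:ℝ) + 1) * (lam * y - n) ≤ (2 * n + 1) * (lam * (2 * m + 2)) :=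
        mul_le_mul_of_nonneg_left (by linarith) (by linarith)
      have q3 : (2 * (n:ℝ) + 1) * (lam * (2 * m + 2)) ≤ (2 * m + 1) * (lam * (2 * m + 2)) :=
        mul_le_mul_of_nonneg_right (by linarith) (by positivity)
      have q4 : 0 ≤ (2 * (m:ℝ) + 1) * (lam * 3) := by positivity
      have : (e:ℝ) < (m + 1) ^ 2 + n ^ 2 := by nlinarith
      exact_mod_cast this
    · obtain ⟨p1, p2⟩ := ham_neg_bounds ⟨mm1, mm2⟩ hy0 m0 h hI
      refine ⟨?_, p2⟩
      apply nextE_le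
      have h1 := hI.2
      rw [ham_box ⟨mm1, mm2⟩ hy0] at h1
      have h' : (n:ℝ) ≤ -1 := by exact_mod_cast (by omega : n ≤ -1)
      have q1 : (2 * (m:ℝ) + 1) * (lam * (2 * m + 3)) ≤ (2 * m + 1) * (lam * x - m) :=
        mul_le_mul_of_nonneg_left (by linarith) (by linarith)
      have q2 : (-(2 * (n:ℝ) + 1)) * (lam * y - n) ≤ (-(2 * n + 1)) * (lam * (2 * m + 2)) :=
        mul_le_mul_of_nonneg_left (by linarith) (by linarith)
      have q3 : (-(2 * (n:ℝ) + 1)) * (lam * (2 * m + 2)) ≤ (2 * m + 1) * (lam * (2 * m + 2)) :=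
        mul_le_mul_of_nonneg_right (by linarith) (by positivity)
      have q4 : 0 ≤ (2 * (m:ℝ) + 1) * (lam * 1) := by positivity
      nlinarith
  · -- X crossing
    right
    subst hc
    have hmne : m' ≠ m := by
      intro h; apply htr; rw [h]
    obtain ⟨x1, x2⟩ := hm'
    have hxe : lam * (x':ℝ) = lam * x + lam * n' - lam * a := by rw [hx']; push_cast; ring
    rcases le_or_gt 0 n' with h | h
    · have h' : (0:ℝ) ≤ n' := by exact_mod_cast h
      have lnn : 0 ≤ lam * (n':ℝ) := by positivity
      have hmm : m + 1 ≤ m' := by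
        have : m ≤ m' := by apply le_of_lt1; linarith
        omega
      have hmm' : m' ≤ m + 1 := by apply le_of_lt1; push_cast; nlinarith
      have hmm2 : m' = m + 1 := by omega
      subst hmm2
      push_cast at *
      have sy : n' + lam * (2 * m + 5) < lam * y := by
        by_contra hcon
        push Not at hcon
        refine not_sig' hl hs ht (m + 1) n' (2 * m + 5) (Or.inr ?_) ?_ ?_ ?_ ?_
        · have := le_abs_self (2 * (m + 1) + 1); omega
        all_goals push_cast; nlinarith
      have ha : a = -n' - 1 := by
        apply le_antisymm _ ha2
        apply le_of_lt1; push_cast; nlinarith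
      subst ha
      obtain ⟨p1, p2⟩ := ham_pos_bounds ⟨mm1, mm2⟩ hy0 m0 h hI
      refine ⟨rfl, by omega, ⟨b, ⟨by push_cast at *; linarith, by push_cast at *; linarith⟩, by omega⟩, Or.inl ⟨h, rfl, ?_, p2⟩⟩
      have h1 := hI.2
      rw [ham_box ⟨mm1, mm2⟩ hy0] at h1
      push_cast at *
      have q1 : (2 * (m:ℝ) + 1) * (1 - lam * (2 * n' + 1)) ≤ (2 * m + 1) * (lam * x - m) :=
        mul_le_mul_of_nonneg_left (by linarith) (by linarith)
      have q2 : (2 * (n':ℝ) + 1) * (lam * (2 * m + 5)) ≤ (2 * (n':ℝ) + 1) * (lam * y - n') :=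
        mul_le_mul_of_nonneg_left (by linarith) (by linarith)
      have q4 : 0 ≤ (2 * (n':ℝ) + 1) * (lam * 4) := by positivity
      have := nextE_le e (m + 1) n' (by push_cast; nlinarith)
      exact this
    · have h' : (n':ℝ) ≤ -1 := by exact_mod_cast (by omega : n' ≤ -1)
      have lnn := lmul_le hl (show n' ≤ -1 by omega)
      push_cast at lnn
      have hmm : m' ≤ m - 1 := by
        have : m' ≤ m := by apply le_of_lt1; linarith
        omega
      have hmm' : m - 1 ≤ m' := by apply le_of_lt1; push_cast; nlinarith
      have hmm2 : m' = m - 1 := by omega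
      subst hmm2
      push_cast at *
      have sy : n' + lam * (2 * m + 3) < lam * y := by
        by_contra hcon
        push Not at hcon
        refine not_sig' hl hs ht m n' (2 * m + 3) (Or.inr ?_) ?_ ?_ ?_ ?_
        · have := le_abs_self (2 * m + 1); omega
        all_goals push_cast; nlinarith
      have ha : a = -n' - 1 := by
        apply le_antisymm _ ha2
        apply le_of_lt1; push_cast; nlinarith
      subst ha
      obtain ⟨p1, p2⟩ := ham_neg_bounds ⟨mm1, mm2⟩ hy0 m0 h hI
      refine ⟨rfl, by omega, ⟨b, ⟨by push_cast at *; linarith, by push_cast at *; linarith⟩, by omega⟩, Or.inr ⟨h, rfl, ?_, p1⟩⟩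
      have h1 := hI.1
      rw [ham_box ⟨mm1, mm2⟩ hy0] at h1
      push_cast at *
      have q1 : (2 * (m:ℝ) + 1) * (lam * x - m) ≤ (2 * (m:ℝ) + 1) * (-(lam * (2 * n' + 1))) :=
        mul_le_mul_of_nonneg_left (by linarith) (by linarith)
      have q2 : (-(2 * (n':ℝ) + 1)) * (lam * (2 * m + 3)) ≤ (-(2 * (n':ℝ) + 1)) * (lam * y - n') :=
        mul_le_mul_of_nonneg_left (by linarith) (by linarith)
      have q4 : 0 ≤ (-(2 * (n':ℝ) + 1)) * (lam * 2) := mul_nonneg (by linarith) (by positivity)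
      have : (e:ℝ) < m ^ 2 + n' ^ 2 := by nlinarith
      exact_mod_cast this



lemma flr_between {lam : ℝ} {a b c m m2 : ℤ} (hl : 0 < lam) (ha : Flr lam a m) (hc : Flr lam c m)
    (hb : Flr lam b m2) (h : (a ≤ b ∧ b ≤ c) ∨ (c ≤ b ∧ b ≤ a)) : m2 = m := by
  rcases h with ⟨h1, h2⟩ | ⟨h1, h2⟩
  · exact le_antisymm (flr_le hl hb hc h2) (flr_le hl ha hb h1)
  · exact le_antisymm (flr_le hl hb ha h2) (flr_le hl hc hb h1)

lemma strip_zero {lam : ℝ} {x x' d t m m2 : ℤ} (hl : 0 < lam) (h1 : Flr lam x m)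
    (h2 : Flr lam x' m) (h3 : Flr lam (x + d) m2) (h4 : Flr lam (x' + d) m2) (hne : m2 ≠ m)
    (ht : x' - x = t * d) : x' = x := by
  by_contra hx
  have ht0 : t ≠ 0 := by
    rintro rfl
    apply hx; linarith
  rcases lt_or_gt_of_ne ht0 with h | h
  · apply hne
    apply flr_between hl h2 h1 h4
    rcases le_total 0 d with hd | hd
    · left; constructor
      · linarith
      · nlinarith
    · right; constructor
      · nlinarith
      · linarith
  · apply hne
    apply flr_between hl h1 h2 h3
    rcases le_total 0 d with hd | hd
    · left; constructor
      · linarith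
      · nlinarith
    · right; constructor
      · nlinarith
      · linarith

def YStep (lam : ℝ) (e : ℕ) (x y m n x' y' m' n' : ℤ) : Prop :=
  m' = m ∧ n' = n - 1 ∧ y' = y - (2 * m + 1) ∧ (∃ a, Flr lam (m - y) a ∧ x' = x + (n - 1) - a) ∧
    m ^ 2 + n ^ 2 ≤ (e : ℤ) ∧ (e : ℤ) < (m + 1) ^ 2 + n ^ 2

def XStep (lam : ℝ) (e : ℕ) (x y m n x' y' m' n' : ℤ) : Prop :=
  n' = n ∧ x' = x + (2 * n + 1) ∧ (∃ b, Flr lam (-n - 1 - x) b ∧ y' = y + b - m) ∧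
    ((0 ≤ n ∧ m' = m + 1 ∧ (m + 1) ^ 2 + n ^ 2 ≤ (e : ℤ) ∧ (e : ℤ) < (m + 1) ^ 2 + (n + 1) ^ 2) ∨
     (n < 0 ∧ m' = m - 1 ∧ (e : ℤ) < m ^ 2 + n ^ 2 ∧ m ^ 2 + (n + 1) ^ 2 ≤ (e : ℤ)))

structure BPath (lam : ℝ) (e : ℕ) (v : ℤ) (x y m n : ℕ → ℤ) (S : ℕ) : Prop where
  fx : ∀ i ≤ S, Flr lam (x i) (m i)
  fy : ∀ i ≤ S, Flr lam (y i) (n i)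
  st : ∀ i < S, -m i - 1 ≤ n i → n i ≤ m i →
    StepR lam e (x i) (y i) (m i) (n i) (x (i + 1)) (y (i + 1)) (m (i + 1)) (n (i + 1))
  ymono : ∀ i < S, y (i + 1) ≤ y i
  xdec : ∀ i < S, n i = -v - 1 → n (i + 1) = -v - 1 → x (i + 1) ≤ x i
  endm : m S = v
  endn : n S = -v - 1

def ExitX (e : ℕ) (m n : ℤ) : Prop :=
  (0 ≤ n ∧ (m + 1) ^ 2 + n ^ 2 ≤ (e : ℤ)) ∨ (n < 0 ∧ (e : ℤ) < m ^ 2 + n ^ 2)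

def XClass (Q m n dx dy : ℤ) : Prop :=
  ∃ S t : ℤ, S * (2 * n + 1) = Q ∧ dx = t * (2 * n + 1) ∧ dy = S - t * (2 * m + 1)

def YClass (Q m n dx dy : ℤ) : Prop :=
  ∃ S t : ℤ, S * (2 * m + 1) = Q ∧ dx = S + t * (2 * n + 1) ∧ dy = -t * (2 * m + 1)

def BRel (e : ℕ) (v Q m n dx dy : ℤ) : Prop :=
  (ExitX e m n ∧ ¬ (m = v ∧ n = -v - 1) → XClass Q m n dx dy) ∧
  (¬ (ExitX e m n ∧ ¬ (m = v ∧ n = -v - 1)) → YClass Q m n dx dy)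

section
variable {lam : ℝ} {e : ℕ} {v : ℤ} {x y m n : ℕ → ℤ} {S : ℕ}

lemma BPath.final (hl : 0 < lam) (hP : BPath lam e v x y m n S) (hv : 0 ≤ v) :
    ∀ d i : ℕ, i + d = S → m i = v → n i = -v - 1 →
      ∃ t : ℤ, x S = x i - t * (2 * v + 1) ∧ y S = y i - t * (2 * v + 1) := by
  -- y is nonincreasing
  have ylow : ∀ d i : ℕ, i + d = S → y S ≤ y i := by
    intro d
    induction d with
    | zero => intro i hi; simp at hi; subst hi; exact le_rfl
    | succ d ih =>
      intro i hi
      exact (ih (i + 1) (by omega)).trans (hP.ymono i (by omega))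
  have nlow : ∀ d i : ℕ, i + d = S → -v - 1 ≤ n i := by
    intro d i hi
    have := flr_le hl (hP.fy S le_rfl) (hP.fy i (by omega)) (ylow d i hi)
    rw [hP.endn] at this
    exact this
  have nfin : ∀ d i : ℕ, i + d = S → n i = -v - 1 → (∀ j, i ≤ j → j ≤ S → n j = -v - 1) := by
    intro d
    induction d with
    | zero => intro i hi hn j h1 h2; have : j = i := by omega
              rw [this]; exact hn
    | succ d ih =>
      intro i hi hn j h1 h2
      rcases Nat.eq_or_lt_of_le h1 with h | h
      · rw [← h]; exact hn
      · have h3 := flr_le hl (hP.fy (i + 1) (by omega)) (hP.fy i (by omega)) (hP.ymono i (by omega))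
        have h4 := nlow d (i + 1) (by omega)
        exact ih (i + 1) (by omega) (by omega) j h h2
  have xlow : ∀ d i : ℕ, i + d = S → n i = -v - 1 → x S ≤ x i := by
    intro d
    induction d with
    | zero => intro i hi hn; simp at hi; subst hi; exact le_rfl
    | succ d ih =>
      intro i hi hn
      have hn1 := nfin (d + 1) i hi hn (i + 1) (by omega) (by omega)
      exact (ih (i + 1) (by omega) hn1).trans (hP.xdec i (by omega) hn hn1)
  intro d
  induction d with
  | zero => intro i hi hm hn; simp at hi; subst hi; exact ⟨0, by simp, by simp⟩
  | succ d ih =>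
    intro i hi hm hn
    have hn1 := nfin (d + 1) i hi hn (i + 1) (by omega) (by omega)
    have hm1 : m (i + 1) = v := by
      have h1 := flr_le hl (hP.fx (i + 1) (by omega)) (hP.fx i (by omega)) (hP.xdec i (by omega) hn hn1)
      have h2 := flr_le hl (hP.fx S le_rfl) (hP.fx (i + 1) (by omega)) (xlow d (i + 1) (by omega) hn1)
      rw [hP.endm] at h2
      omega
    obtain ⟨t, ht1, ht2⟩ := ih (i + 1) (by omega) hm1 hn1
    have hst := hP.st i (by omega) (by omega) (by omega)
    rcases hst with ⟨_, _, h3, h4⟩ | ⟨_, h2, _⟩ | ⟨_, _, _, ⟨_, h2, _⟩ | ⟨_, h2, _⟩⟩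
    · refine ⟨t + 1, ?_, ?_⟩
      · rw [ht1, h3, hn]; ring
      · rw [ht2, h4, hm]; ring
    · omega
    · omega
    · omega

lemma BPath.exit (hP : BPath lam e v x y m n S) :
    ∀ d i : ℕ, i + d = S → v ≤ m i → -v - 1 ≤ n i → n i ≤ v → ¬ (m i = v ∧ n i = -v - 1) →
      ∃ (k : ℕ) (t : ℤ), i ≤ k ∧ k < S ∧ x k = x i + t * (2 * n i + 1) ∧
        y k = y i - t * (2 * m i + 1) ∧ m k = m i ∧ n k = n i ∧
        (YStep lam e (x k) (y k) (m i) (n i) (x (k + 1)) (y (k + 1)) (m (k + 1)) (n (k + 1)) ∨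
         XStep lam e (x k) (y k) (m i) (n i) (x (k + 1)) (y (k + 1)) (m (k + 1)) (n (k + 1))) := by
  intro d
  induction d with
  | zero =>
    intro i hi _ _ _ h
    simp at hi
    subst hi
    exact absurd ⟨hP.endm, hP.endn⟩ h
  | succ d ih =>
    intro i hi h1 h2 h3 h4
    rcases hP.st i (by omega) (by omega) (by omega) with ⟨e1, e2, e3, e4⟩ | h | h
    · obtain ⟨k, t, k1, k2, k3, k4, k5, k6, k7⟩ :=
        ih (i + 1) (by omega) (by rw [e1]; exact h1) (by rw [e2]; exact h2) (by rw [e2]; exact h3)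
          (by rw [e1, e2]; exact h4)
      rw [e1, e2] at k7
      rw [e1] at k4 k5
      rw [e2] at k3 k6
      refine ⟨k, t + 1, by omega, k2, ?_, ?_, k5, k6, k7⟩
      · rw [k3, e3]; ring
      · rw [k4, e4]; ring
    · exact ⟨i, 0, le_rfl, by omega, by ring, by ring, rfl, rfl, Or.inl h⟩
    · exact ⟨i, 0, le_rfl, by omega, by ring, by ring, rfl, rfl, Or.inr h⟩

end

/-- conversion after a Y step -/
lemma after_Y {e : ℕ} {v K S m n : ℤ} (hv1 : 2 * v ^ 2 ≤ (e : ℤ)) (hv0 : 0 ≤ v)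
    (hm : v ≤ m) (hn1 : -v - 1 ≤ n - 1) (hn2 : n ≤ v)
    (h1 : m ^ 2 + n ^ 2 ≤ (e : ℤ)) (h2 : (e : ℤ) < (m + 1) ^ 2 + n ^ 2)
    (hS : S * (2 * m + 1) = K * qe e) : BRel e v (K * qe e) m (n - 1) S 0 := by
  constructor
  · rintro ⟨hx, hf⟩
    have hd : (2 * m + 1) * (2 * n - 1) ∣ (qe e : ℤ) := by
      rcases hx with ⟨g1, g2⟩ | ⟨g1, g2⟩
      · have := adj1 e m (n - 1) g1 (by omega) (by rw [sub_add_cancel]; exact h1) g2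
          (by rw [sub_add_cancel]; exact h2)
        have e1 : 2 * (n - 1) + 1 = 2 * n - 1 := by ring
        rwa [e1] at this
      · by_cases hn0 : n = 0
        · subst hn0
          have := adj0 e m (by omega) (by simpa using h1) (by simpa using h2)
          have e1 : (2 * m + 1) * (2 * 0 - 1) = -(2 * m + 1) := by ring
          rw [e1]
          exact neg_dvd.2 this
        · have := adj2 e m (-n) (by omega) (by omega) (by simpa using h1)
            (by nlinarith) (by simpa using h2)
          have e1 : (2 * m + 1) * (2 * -n + 1) = - ((2 * m + 1) * (2 * n - 1)) := by ring
          rw [e1] at this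
          exact (neg_dvd).1 this
    obtain ⟨w, hw⟩ := hd
    have hS' : S = K * w * (2 * n - 1) := by
      have : (S - K * w * (2 * n - 1)) * (2 * m + 1) = 0 := by
        rw [sub_mul, hS, hw]; ring
      rcases mul_eq_zero.1 this with h | h
      · linarith
      · omega
    refine ⟨K * w * (2 * m + 1), K * w, ?_, ?_, ?_⟩
    · rw [hw]; ring
    · rw [hS']; ring
    · ring
  · intro _
    exact ⟨S, 0, hS, by ring, by ring⟩

/-- conversion after an X step -/
lemma after_X {e : ℕ} {v K S m n m' : ℤ} (hve : v = (Nat.sqrt (e / 2) : ℤ))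
    (hm : v ≤ m) (hm' : v ≤ m') (hn1 : -v - 1 ≤ n) (hn2 : n ≤ v)
    (h : (0 ≤ n ∧ m' = m + 1 ∧ (m + 1) ^ 2 + n ^ 2 ≤ (e : ℤ) ∧ (e : ℤ) < (m + 1) ^ 2 + (n + 1) ^ 2) ∨
     (n < 0 ∧ m' = m - 1 ∧ (e : ℤ) < m ^ 2 + n ^ 2 ∧ m ^ 2 + (n + 1) ^ 2 ≤ (e : ℤ)))
    (hS : S * (2 * n + 1) = K * qe e) : BRel e v (K * qe e) m' n 0 S := by
  constructor
  · intro _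
    exact ⟨S, 0, hS, by ring, by ring⟩
  · intro hx
    have hd : (2 * m' + 1) * (2 * n + 1) ∣ (qe e : ℤ) := by
      by_cases hf : m' = v ∧ n = -v - 1
      · obtain ⟨rfl, rfl⟩ := hf
        have := v1_sq_dvd e
        have h2 : ((2 * m' + 1) ^ 2 : ℤ) ∣ (qe e : ℤ) := by
          rw [hve]; exact_mod_cast this
        have e1 : (2 * m' + 1) * (2 * (-m' - 1) + 1) = - (2 * m' + 1) ^ 2 := by ring
        rw [e1]
        exact neg_dvd.2 h2
      · have hx' : ¬ ExitX e m' n := fun h => hx ⟨h, hf⟩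
        unfold ExitX at hx'
        push Not at hx'
        rcases h with ⟨g1, g2, g3, g4⟩ | ⟨g1, g2, g3, g4⟩
        · subst g2
          exact adj2 e (m + 1) n g1 (by omega) g3 g4 (hx'.1 g1)
        · subst g2
          have := adj1 e (m - 1) (-n - 1) (by omega) (by omega) (by have := hx'.2 g1; nlinarith)
            (by nlinarith) (by nlinarith)
          have e1 : (2 * (m - 1) + 1) * (2 * (-n - 1) + 1) = - ((2 * (m - 1) + 1) * (2 * n + 1)) := by
            ring
          rw [e1] at this
          exact neg_dvd.1 this
    obtain ⟨w, hw⟩ := hd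
    have hS' : S = K * w * (2 * m' + 1) := by
      have : (S - K * w * (2 * m' + 1)) * (2 * n + 1) = 0 := by
        rw [sub_mul, hS, hw]; ring
      rcases mul_eq_zero.1 this with h | h
      · linarith
      · omega
    refine ⟨K * w * (2 * n + 1), - (K * w), ?_, ?_, ?_⟩
    · rw [hw]; ring
    · ring
    · rw [hS']; ring

set_option maxHeartbeats 1000000 in
lemma track {lam : ℝ} {e : ℕ} {v K : ℤ} {x y m n x' y' m' n' : ℕ → ℤ} {S S' : ℕ}
    (hl : 0 < lam) (hve : v = (Nat.sqrt (e / 2) : ℤ))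
    (hv1 : 2 * v ^ 2 ≤ (e : ℤ)) (hv2 : (e : ℤ) < 2 * (v + 1) ^ 2) (hv0 : 0 ≤ v)
    (hP : BPath lam e v x y m n S) (hP' : BPath lam e v x' y' m' n' S') :
    ∀ d i i' : ℕ, i + d = S → i' ≤ S' → m' i' = m i → n' i' = n i →
      v ≤ m i → -v - 1 ≤ n i → n i ≤ v →
      BRel e v (K * qe e) (m i) (n i) (x' i' - x i) (y' i' - y i) →
      ∃ S0 t : ℤ, S0 * (2 * v + 1) = K * qe e ∧ x' S' - x S = S0 - t * (2 * v + 1) ∧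
        y' S' - y S = -t * (2 * v + 1) := by
  intro d
  induction d using Nat.strong_induction_on with
  | _ d ih =>
  intro i i' hi hi' hmm hnn h1 h2 h3 hR
  by_cases hf : m i = v ∧ n i = -v - 1
  · obtain ⟨t1, a1, a2⟩ := hP.final hl hv0 d i hi hf.1 hf.2
    obtain ⟨t2, b1, b2⟩ := hP'.final hl hv0 (S' - i') i' (by omega) (hmm.trans hf.1) (hnn.trans hf.2)
    obtain ⟨S0, t, c1, c2, c3⟩ := hR.2 (fun h => h.2 hf)
    rw [hf.1] at c1 c3
    rw [hf.2] at c2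
    refine ⟨S0, t + t2 - t1, c1, ?_, ?_⟩
    · rw [a1, b1]; linear_combination c2
    · rw [a2, b2]; linear_combination c3
  · obtain ⟨k, t, k1, k2, k3, k4, km, kn, k5⟩ := hP.exit d i hi h1 h2 h3 hf
    obtain ⟨k', t', l1, l2, l3, l4, lm, ln, l5⟩ := hP'.exit (S' - i') i' (by omega) (by omega) (by omega)
      (by omega) (by rw [hmm, hnn]; exact hf)
    rw [hmm, hnn] at l5
    rw [hmm] at l4 lm
    rw [hnn] at l3 ln
    have fxk := hP.fx k (by omega)
    have fyk := hP.fy k (by omega)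
    have fxl := hP'.fx k' (by omega)
    have fyl := hP'.fy k' (by omega)
    have fxk1 := hP.fx (k + 1) (by omega)
    have fyk1 := hP.fy (k + 1) (by omega)
    have fxl1 := hP'.fx (k' + 1) (by omega)
    have fyl1 := hP'.fy (k' + 1) (by omega)
    rw [km] at fxk
    rw [kn] at fyk
    rw [lm] at fxl
    rw [ln] at fyl
    by_cases hx : ExitX e (m i) (n i)
    · obtain ⟨S0, t0, c1, c2, c3⟩ := hR.1 ⟨hx, hf⟩
      rcases k5 with ⟨_, _, _, _, q1, q2⟩ | ⟨p1, p2, ⟨b, pb, p3⟩, p4⟩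
      · exfalso; rcases hx with ⟨g1, g2⟩ | ⟨g1, g2⟩
        · linarith
        · linarith
      rcases l5 with ⟨_, _, _, _, q1, q2⟩ | ⟨r1, r2, ⟨b', rb, r3⟩, r4⟩
      · exfalso; rcases hx with ⟨g1, g2⟩ | ⟨g1, g2⟩
        · linarith
        · linarith
      have hmeq : m' (k' + 1) = m (k + 1) := by
        rcases p4 with ⟨u1, u2, _⟩ | ⟨u1, u2, _⟩ <;> rcases r4 with ⟨w1, w2, _⟩ | ⟨w1, w2, _⟩ <;> omega
      have hmne : m (k + 1) ≠ m i := by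
        rcases p4 with ⟨u1, u2, _⟩ | ⟨u1, u2, _⟩ <;> omega
      rw [p2] at fxk1
      rw [r2, hmeq] at fxl1
      have hxx : x' k' = x k := by
        apply strip_zero (t := t0 + t' - t) hl fxk fxl fxk1 fxl1 hmne
        rw [k3, l3]; linear_combination c2
      have hdx : t0 + t' - t = 0 := by
        have : (t0 + t' - t) * (2 * n i + 1) = 0 := by
          linear_combination hxx - l3 + k3 - c2
        rcases mul_eq_zero.1 this with h | h
        · exact h
        · omega
      have hdy : y' k' - y k = S0 := by
        rw [k4, l4]; linear_combination c3 - (2 * m i + 1) * hdx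
      have hbb : b' = b := by
        rw [hxx] at rb
        exact flr_unique rb pb
      have hvm : v ≤ m (k + 1) := by
        rcases p4 with ⟨u1, u2, _⟩ | ⟨u1, u2, u3, u4⟩
        · omega
        · by_contra hc
          have hmv : m i = v := by omega
          have : n i ≠ -v - 1 := fun h => hf ⟨hmv, h⟩
          have hnv : -v ≤ n i := by omega
          rw [hmv] at u3
          have := sq_le_sq' hnv h3
          linarith
      have hR' := after_X (K := K) (S := S0) hve h1 hvm h2 h3 p4 c1
      apply ih (S - (k + 1)) (by omega) (k + 1) (k' + 1) (by omega) (by omega) hmeq (by rw [p1, r1]) hvm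
        (by rw [p1]; exact h2) (by rw [p1]; exact h3)
      have e1 : x' (k' + 1) - x (k + 1) = 0 := by rw [r2, p2, hxx]; ring
      have e2 : y' (k' + 1) - y (k + 1) = S0 := by rw [r3, p3, hbb, ← hdy]; ring
      rw [e1, e2, p1]
      exact hR'
    · obtain ⟨S0, t0, c1, c2, c3⟩ := hR.2 (fun h => hx h.1)
      rcases k5 with ⟨p1, p2, p3, ⟨a, pa, p4⟩, q1, q2⟩ | ⟨_, _, _, p4⟩
      swap
      · exfalso; apply hx; rcases p4 with ⟨u1, _, u2, _⟩ | ⟨u1, _, u2, _⟩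
        · exact Or.inl ⟨u1, u2⟩
        · exact Or.inr ⟨u1, u2⟩
      rcases l5 with ⟨r1, r2, r3, ⟨a', ra, r4⟩, _, _⟩ | ⟨_, _, _, p4⟩
      swap
      · exfalso; apply hx; rcases p4 with ⟨u1, _, u2, _⟩ | ⟨u1, _, u2, _⟩
        · exact Or.inl ⟨u1, u2⟩
        · exact Or.inr ⟨u1, u2⟩
      rw [p3, p2, sub_eq_add_neg (y k)] at fyk1
      rw [r3, r2, sub_eq_add_neg (y' k')] at fyl1
      have hyy : y' k' = y k := by
        apply strip_zero (t := t0 + t' - t) hl fyk fyl fyk1 fyl1 (by omega)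
        rw [k4, l4]; linear_combination c3
      have hdt : t0 + t' - t = 0 := by
        have : (t0 + t' - t) * (2 * m i + 1) = 0 := by
          linear_combination -hyy + l4 - k4 + c3
        rcases mul_eq_zero.1 this with h | h
        · exact h
        · omega
      have hdx : x' k' - x k = S0 := by
        rw [k3, l3]; linear_combination c2 + (2 * n i + 1) * hdt
      have haa : a' = a := by
        rw [hyy] at ra
        exact flr_unique ra pa
      have hnv : -v - 1 ≤ n i - 1 := by
        by_contra hc
        have hn : n i = -v - 1 := by omega
        have hmv : v + 1 ≤ m i := by
          have : m i ≠ v := fun h => hf ⟨h, hn⟩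
          omega
        apply hx
        right
        refine ⟨by omega, ?_⟩
        rw [hn]
        have : (v + 1) ^ 2 ≤ (m i) ^ 2 := pow_le_pow_left₀ (by omega) hmv 2
        have e3 : (-v - 1) ^ 2 = (v + 1) ^ 2 := by ring
        rw [e3]
        linarith
      have hR' := after_Y (K := K) (S := S0) hv1 hv0 h1 hnv h3 q1 q2 c1
      apply ih (S - (k + 1)) (by omega) (k + 1) (k' + 1) (by omega) (by omega) (by rw [p1, r1])
        (by rw [p2, r2]) (by rw [p1]; exact h1) (by rw [p2]; exact hnv) (by rw [p2]; omega)
      have e1 : x' (k' + 1) - x (k + 1) = S0 := by rw [r4, p4, haa, ← hdx]; ring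
      have e2 : y' (k' + 1) - y (k + 1) = 0 := by rw [r3, p3, hyy]; ring
      rw [e1, e2, p1, p2]
      exact hR'

lemma rel_start {e : ℕ} {v K t S : ℤ} (hve : v = (Nat.sqrt (e / 2) : ℤ)) (hv0 : 0 ≤ v)
    (hS : S * (2 * v + 1) = K * qe e) :
    BRel e v (K * qe e) v v (t * (2 * v + 1)) (S - t * (2 * v + 1)) := by
  constructor
  · intro _
    exact ⟨S, t, hS, rfl, rfl⟩
  · intro _
    have h2 : ((2 * v + 1) ^ 2 : ℤ) ∣ (qe e : ℤ) := by
      have := v1_sq_dvd e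
      rw [hve]; exact_mod_cast this
    obtain ⟨w, hw⟩ := h2
    have hS' : S = K * w * (2 * v + 1) := by
      have : (S - K * w * (2 * v + 1)) * (2 * v + 1) = 0 := by
        rw [sub_mul, hS, hw]; ring
      rcases mul_eq_zero.1 this with h | h
      · linarith
      · omega
    refine ⟨S, t - K * w, hS, ?_, ?_⟩
    · rw [hS']; ring
    · rw [hS']; ring



lemma path_exists {lam : ℝ} {e : ℕ} {v X Y V M K : ℤ} (hl : 0 < lam) (he : 1 ≤ e)
    (hsm : lam * (100 * ((e : ℝ) + 2) ^ 2) ≤ 1) (hsm2 : lam * (20 * (e : ℝ) + 40) ≤ 1)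
    (hV : V = v + 1) (hM : M = V * (2 * V + 2)) (hlM : lam * (8 * (M : ℝ) + 40) ≤ 1)
    (hK : K = (2 * M + 5) * (8 * M + 40) + (2 * M + 4) * (M + 2 * (4 * M + 6)))
    (hlK : lam * (4 * (K : ℝ)) ≤ 1)
    (hv0 : 0 ≤ v) (hv1 : 2 * v ^ 2 ≤ (e : ℤ)) (hv2 : (e : ℤ) < 2 * (v + 1) ^ 2)
    (hB : Boxed lam v X Y) (hR : RegularPt lam e (X, Y)) :
    ∃ (x y m n : ℕ → ℤ) (S : ℕ), x 0 = X ∧ y 0 = Y ∧ m 0 = v ∧ n 0 = v ∧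
      BPath lam e v x y m n S ∧
      Phi lam (X, Y) = (v - y S - (2 * v + 1), x S + (2 * v + 1)) := by
  obtain ⟨hX, hI, ht, htP, hIk, hSk⟩ := hR
  obtain ⟨x, y, m, a, b, c, hO⟩ := orb_exists lam (X, Y)
  have h0 := hO.h0
  obtain ⟨hx0, hy0⟩ := Prod.mk.inj h0
  have hv0' : (0:ℝ) ≤ v := by exact_mod_cast hv0
  have hXq : (1:ℝ) / 4 ≤ lam * X := by
    rcases eq_or_lt_of_le hv0 with h | h
    · subst h
      have h1 := hI.1
      rw [ham_box hB.hx hB.hy] at h1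
      have he' : (1:ℝ) ≤ e := by exact_mod_cast he
      push_cast at h1
      have h2 : (-1 : ℝ) ≤ X - Y := by exact_mod_cast hB.u
      have h3 := mul_le_mul_of_nonneg_left h2 hl.le
      nlinarith
    · have h1 : (1:ℝ) ≤ v := by exact_mod_cast h
      have := hB.hx.1
      linarith
  have hKX : K ≤ X := by
    apply of_lmul_le hl
    linarith
  have hO' := hO
  obtain ⟨s, hs1, hs2, hs3, hs4⟩ := robust_return hO hX hl (by omega) hM (by exact_mod_cast hlM)
    (by rw [← hx0, hV]; push_cast; exact hB.hx.2) (by rw [← hy0, hV]; push_cast; exact hB.hy.2)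
    (by rw [← hK, ← hx0]; exact hKX)
  have hPhi : Phi lam (X, Y) = (m s - y s, x s) := by
    unfold Phi
    rw [zpow_nat_apply, hs2, hO.pow1]
  rw [hO.pow1] at hs3
  rw [hPhi] at htP
  have hIP := hIk (4 * s + 1) (by omega)
  rw [zpow_nat_apply, hO.pow1] at hIP
  have hcl := classify hl he hsm hv0 hv1 hv2 hs3 htP hIP
  have hbox : Boxed lam v (m s - y s) (x s) := by
    rcases hcl.2 with ⟨g1, g2, g3, g4, g5, g6⟩ | ⟨V', _, _, hsig⟩
    · exact ⟨g1, g2, g3, g4, g5, g6⟩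
    · exfalso
      obtain ⟨r, rfl⟩ : ∃ r, s = r + 1 := ⟨s - 1, by omega⟩
      rw [hO.back1, ← hO.pow1, ← zpow_nat_apply] at hsig
      exact hSk (4 * r + 1) (by omega) hsig
  have hms : m s = v := flr_unique (hO.ch s).hm hbox.hy
  have hst := hO.step1 s
  rw [hbox.hF] at hst
  obtain ⟨q1, q2⟩ := Prod.mk.inj hst
  have hms1 : m (s + 1) = v := by
    have := hbox.hy'
    rw [q2] at this
    exact flr_unique (hO.ch (s + 1)).hm this
  have hys1 : y (s + 1) = v - (m s - y s) - (2 * v + 1) := by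
    rw [hms1] at q1; linarith
  have hns1 : Flr lam (y (s + 1)) (-v - 1) := by
    rw [hys1]
    have h1 := hbox.hx.1
    have h2 := hbox.hx'.2
    have h3 : 0 ≤ lam * (v:ℝ) := mul_nonneg hl.le hv0'
    push_cast at h1 h2
    constructor
    · push_cast
      nlinarith
    · push_cast
      nlinarith
  refine ⟨x, y, m, fun i => ⌊lam * (y i : ℝ)⌋, s + 1, hx0.symm, hy0.symm, ?_, ?_, ?_, ?_⟩
  · have := (hO.ch 0).hm
    rw [← hx0] at this
    exact flr_unique this hB.hx
  · simp only
    rw [← hy0]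
    exact flr_iff.1 hB.hy
  · refine ⟨fun i _ => (hO.ch i).hm, fun i _ => flr_floor _ _, ?_, ?_, ?_, hms1, flr_iff.1 hns1⟩
    · intro i hi n1 n2
      obtain ⟨sf, _⟩ := hs4 i (by omega)
      have i1 := hIk (4 * i) (by omega)
      have i2 := hSk (4 * i) (by omega)
      rw [zpow_nat_apply, hO.pow] at i1 i2
      exact step_lemma hl hsm2 (hO.ch i) (flr_floor _ _) sf.m0 sf.ax sf.la i1 i2 n1 n2 (hO.sx i)
        (hO.sy i) (hO.ch (i + 1)).hm (flr_floor _ _)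
    · intro i hi
      obtain ⟨sf, _⟩ := hs4 i (by omega)
      rw [hO.sy]
      have := sf.b1
      have := sf.m0
      omega
    · intro i hi n1 n2
      obtain ⟨sf, _⟩ := hs4 i (by omega)
      have hy1 : Flr lam (y i) (-v - 1) := flr_iff.2 n1
      have hyn : y i ≤ 0 := by
        have := hy1.2
        push_cast at this
        have h2 : lam * (y i : ℝ) < lam * (0 : ℤ) := by push_cast; linarith
        exact (of_lmul_lt hl h2).le
      have := sf.low (hyn.trans sf.m0)
      rw [hO.sx]
      omega
  · rw [hPhi]
    ext
    · simp only; linarith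
    · simp only; linarith

lemma equivariance_pos {lam : ℝ} {e : ℕ} {I : Set ℝ} {v V M K : ℤ} (hl : 0 < lam) (he : 1 ≤ e)
    (hsm : lam * (100 * ((e : ℝ) + 2) ^ 2) ≤ 1) (hsm2 : lam * (20 * (e : ℝ) + 40) ≤ 1)
    (hve : v = (Nat.sqrt (e / 2) : ℤ))
    (hV : V = v + 1) (hM : M = V * (2 * V + 2)) (hlM : lam * (8 * (M : ℝ) + 40) ≤ 1)
    (hK : K = (2 * M + 5) * (8 * M + 40) + (2 * M + 4) * (M + 2 * (4 * M + 6)))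
    (hlK : lam * (4 * (K : ℝ)) ≤ 1) (hI : I.OrdConnected)
    (hreg : ∀ p ∈ Xset lam, ham (pt lam p) ∈ I → RegularPt lam e p)
    (l : ℤ × ℤ) (hle : l ∈ latticeE e) (p : ℤ × ℤ)
    (hp : p ∈ Xset lam ∧ ham (pt lam p) ∈ I)
    (hp' : p + l ∈ Xset lam ∧ ham (pt lam (p + l)) ∈ I) :
    ∃ j : ℤ, Phi lam (p + l) = Phi lam p + l + j • w1vec e := by
  have hv0 : 0 ≤ v := by omega
  have hv1 : 2 * v ^ 2 ≤ (e : ℤ) := by rw [hve]; exact_mod_cast (v1_spec e).1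
  have hv2 : (e : ℤ) < 2 * (v + 1) ^ 2 := by rw [hve]; exact_mod_cast (v1_spec e).2
  obtain ⟨k, t, S, hS, hlt⟩ := lattice_coords e l hle
  rw [← hve] at hS hlt
  have hw : w1vec e = (2 * v + 1, -(2 * v + 1)) := by unfold w1vec; rw [hve]
  obtain ⟨w, hw2⟩ : (2 * v + 1) ^ 2 ∣ (qe e : ℤ) := by
    have := v1_sq_dvd e
    rw [hve]; exact_mod_cast this
  have hSd : S = k * w * (2 * v + 1) := by
    have : (S - k * w * (2 * v + 1)) * (2 * v + 1) = 0 := by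
      rw [sub_mul, hS, hw2]; ring
    rcases mul_eq_zero.1 this with h | h
    · linarith
    · omega
  obtain ⟨x0, y0⟩ := p
  rw [hlt] at hp' ⊢
  rw [Prod.mk_add_mk] at hp' ⊢
  rcases start_boxed hl he hsm hv0 hv1 hv2 hI hreg hp.1 hp.2 hp'.1 hp'.2 ⟨t, by ring⟩
    ⟨k * w - t, by rw [hSd]; ring⟩ with ⟨g1, g2⟩ | ⟨g1, g2⟩
  · refine ⟨0, ?_⟩
    have e1 : t * (2 * v + 1) = 0 := by linarith
    have e2 : S - t * (2 * v + 1) = 0 := by linarith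
    rw [e2, e1]
    ext <;> simp
  · obtain ⟨x, y, m, n, s, i1, i2, i3, i4, hP, hPhi⟩ := path_exists hl he hsm hsm2 hV hM hlM hK hlK
      hv0 hv1 hv2 g1 (hreg _ hp.1 hp.2)
    obtain ⟨x', y', m', n', s', j1, j2, j3, j4, hP', hPhi'⟩ := path_exists hl he hsm hsm2 hV hM hlM hK hlK
      hv0 hv1 hv2 g2 (hreg _ hp'.1 hp'.2)
    have hR := rel_start (t := t) hve hv0 hS
    have hT := track (K := k) hl hve hv1 hv2 hv0 hP hP' s 0 0 (by omega) (by omega) (by rw [i3, j3])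
      (by rw [i4, j4]) (by rw [i3]) (by rw [i4]; omega) (by rw [i4])
      (by
        rw [i1, i2, i3, i4, j1, j2]
        convert hR using 1 <;> ring)
    obtain ⟨S0, u, u1, u2, u3⟩ := hT
    have hS0 : S0 = S := by
      have : (S0 - S) * (2 * v + 1) = 0 := by rw [sub_mul, u1, hS]; ring
      rcases mul_eq_zero.1 this with h | h
      · linarith
      · omega
    subst hS0
    refine ⟨u - t, ?_⟩
    rw [hPhi, hPhi', hw]
    ext
    · simp only [Prod.fst_add, Prod.smul_fst, smul_eq_mul]
      linear_combination -u3
    · simp only [Prod.snd_add, Prod.smul_snd, smul_eq_mul]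
      linear_combination u2



/-- invariant set for the exceptional class `e = 0` -/
def ZInv (s : ℤ) (q : ℤ × ℤ) : Prop :=
  (0 ≤ q.1 ∧ 0 ≤ q.2 ∧ q.1 + q.2 = s) ∨ (q.1 ≤ 0 ∧ 0 ≤ q.2 ∧ q.2 - q.1 = s) ∨
  (q.1 ≤ -1 ∧ q.2 ≤ -1 ∧ q.1 + q.2 = -1 - s) ∨ (0 ≤ q.1 ∧ q.2 ≤ -1 ∧ q.1 - q.2 = s)

lemma ZInv.step {lam : ℝ} {s : ℤ} {q : ℤ × ℤ} (hl : 0 < lam) (hs : lam * (s : ℝ) < 1)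
    (h : ZInv s q) : ZInv s (Fe lam q) := by
  obtain ⟨u, w⟩ := q
  have f0 : 0 ≤ u → u ≤ s → Flr lam u 0 := by
    intro h1 h2
    have a1 := lmul_le hl h1
    have a2 := lmul_le hl h2
    constructor <;> push_cast at * <;> linarith
  have f1 : u ≤ -1 → -s ≤ u → Flr lam u (-1) := by
    intro h1 h2
    have a1 := lmul_le hl h1
    have a2 := lmul_le hl h2
    constructor <;> push_cast at * <;> linarith
  unfold ZInv at h ⊢
  simp only at h
  rcases h with ⟨h1, h2, h3⟩ | ⟨h1, h2, h3⟩ | ⟨h1, h2, h3⟩ | ⟨h1, h2, h3⟩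
  · rw [Fe_flr (f0 h1 (by omega))]; simp only; omega
  · rcases eq_or_lt_of_le h1 with h | h
    · rw [Fe_flr (f0 (by omega) (by omega))]; simp only; omega
    · rw [Fe_flr (f1 (by omega) (by omega))]; simp only; omega
  · rw [Fe_flr (f1 (by omega) (by omega))]; simp only; omega
  · rw [Fe_flr (f0 (by omega) (by omega))]; simp only; omega

lemma Phi_sum_zero {lam : ℝ} (hl : 0 < lam) {p : ℤ × ℤ} (hX : p ∈ Xset lam)
    (hI : ham (pt lam p) ∈ Ie 0) : (Phi lam p).1 + (Phi lam p).2 = p.1 + p.2 := by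
  obtain ⟨x, y⟩ := p
  have hx : 0 ≤ x := hX.1
  have hy : 0 ≤ y := hX.2.1
  have fx := flr_floor lam x
  have fy := flr_floor lam y
  have hm : 0 ≤ ⌊lam * (x : ℝ)⌋ := Int.floor_nonneg.2 (by positivity)
  have hn : 0 ≤ ⌊lam * (y : ℝ)⌋ := Int.floor_nonneg.2 (by positivity)
  have hb := (ham_pos_bounds fx fy hm hn hI).1
  have hm0 : ⌊lam * (x : ℝ)⌋ = 0 := by push_cast at hb; nlinarith
  have hn0 : ⌊lam * (y : ℝ)⌋ = 0 := by push_cast at hb; nlinarith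
  rw [hm0] at fx
  rw [hn0] at fy
  have h2 := hI.2
  rw [ham_box fx fy] at h2
  have hnx : nextE 0 ≤ 1 := Nat.sInf_le ⟨by norm_num, 1, 0, by norm_num⟩
  have hnx' : (nextE 0 : ℝ) ≤ 1 := by exact_mod_cast hnx
  have hs : lam * ((x + y : ℤ) : ℝ) < 1 := by push_cast at h2 ⊢; linarith
  have hinv : ∀ k : ℕ, ZInv (x + y) ((Fe lam ^ k) (x, y)) := by
    intro k
    induction k with
    | zero => left; simp [hx, hy]
    | succ k ih =>
      rw [pow_succ', Equiv.Perm.mul_apply]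
      exact ih.step hl hs
  by_cases hne : {k : ℕ | 1 ≤ k ∧ (Fe lam ^ (k : ℤ)) (x, y) ∈ Xset lam}.Nonempty
  · have hmem : Phi lam (x, y) ∈ Xset lam := (Nat.sInf_mem hne).2
    have h1 : 0 ≤ (Phi lam (x, y)).1 := hmem.1
    have h3 : 0 ≤ (Phi lam (x, y)).2 := hmem.2.1
    have hz := hinv (tauPlus lam (x, y))
    rw [← zpow_nat_apply] at hz
    change ZInv (x + y) (Phi lam (x, y)) at hz
    unfold ZInv at hz
    simp only
    omega
  · have ht : tauPlus lam (x, y) = 0 := by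
      unfold tauPlus
      rw [Set.not_nonempty_iff_eq_empty.1 hne, Nat.sInf_empty]
    unfold Phi
    rw [ht]
    simp

/-- **Equivariance of the return map** (Theorem 4.2 / `thm:Phi_equivariance`).
For every `e ∈ ℰ` there is `λ₀ > 0` such that for every `0 < λ < λ₀` and every
interval `I ⊆ ℐ^e` all of whose `X`-points are regular, setting
`X^e = {z ∈ X : 𝒫(z) ∈ I}`, the return map `Φ` commutes with translation by
`λ·𝕃^e` on `X^e`, modulo the local vector field `λ𝐰₁`:
`Φ(z + λl) = Φ(z) + λl + j·λ𝐰₁` for some `j ∈ ℤ`. -/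
theorem Phi_equivariance (e : ℕ) (he : sumTwoSq e) :
    ∃ lam0 > (0:ℝ), ∀ lam : ℝ, 0 < lam → lam < lam0 →
      ∀ I : Set ℝ, I ⊆ Ie e → I.OrdConnected →
        (∀ p ∈ Xset lam, ham (pt lam p) ∈ I → RegularPt lam e p) →
        ∀ l ∈ latticeE e, ∀ p : ℤ × ℤ,
          (p ∈ Xset lam ∧ ham (pt lam p) ∈ I) →
          (p + l ∈ Xset lam ∧ ham (pt lam (p + l)) ∈ I) →
          ∃ j : ℤ, Phi lam (p + l) = Phi lam p + l + j • w1vec e := by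
  rcases Nat.eq_zero_or_pos e with h0 | h0
  · subst h0
    refine ⟨1, one_pos, ?_⟩
    intro lam hl _ I hI _ _ l _ p hp hp'
    have h1 := Phi_sum_zero hl hp.1 (hI hp.2)
    have h2 := Phi_sum_zero hl hp'.1 (hI hp'.2)
    refine ⟨(Phi lam (p + l)).1 - (Phi lam p).1 - l.1, ?_⟩
    rw [Prod.fst_add, Prod.snd_add] at h2
    have hw : w1vec 0 = (1, -1) := by simp [w1vec]
    rw [hw]
    ext
    · simp only [Prod.fst_add, Prod.smul_fst, smul_eq_mul]
      ring
    · simp only [Prod.snd_add, Prod.smul_snd, smul_eq_mul]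
      linarith
  · obtain ⟨v, hv⟩ : ∃ v : ℤ, v = (Nat.sqrt (e / 2) : ℤ) := ⟨_, rfl⟩
    have hv0 : 0 ≤ v := by omega
    obtain ⟨V, hV⟩ : ∃ V : ℤ, V = v + 1 := ⟨_, rfl⟩
    have hV0 : 0 ≤ V := by omega
    obtain ⟨M, hM⟩ : ∃ M : ℤ, M = V * (2 * V + 2) := ⟨_, rfl⟩
    have hM0 : 0 ≤ M := by rw [hM]; positivity
    obtain ⟨K, hK⟩ : ∃ K : ℤ,
      K = (2 * M + 5) * (8 * M + 40) + (2 * M + 4) * (M + 2 * (4 * M + 6)) := ⟨_, rfl⟩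
    have hK0 : 0 ≤ K := by rw [hK]; positivity
    have hM0' : (0:ℝ) ≤ M := by exact_mod_cast hM0
    have hK0' : (0:ℝ) ≤ K := by exact_mod_cast hK0
    obtain ⟨T, hT⟩ : ∃ T : ℝ, T = 100 * ((e : ℝ) + 2) ^ 2 + (20 * (e : ℝ) + 40) + (8 * (M : ℝ) + 40) +
      4 * (K : ℝ) := ⟨_, rfl⟩
    have t1 : (0:ℝ) ≤ 100 * ((e : ℝ) + 2) ^ 2 := by positivity
    have t2 : (0:ℝ) ≤ 20 * (e : ℝ) := by positivity
    have hTp : 0 < T := by rw [hT]; linarith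
    refine ⟨1 / T, by positivity, ?_⟩
    intro lam hl hl0 I hI hIc hreg l hle p hp hp'
    have hlT : lam * T ≤ 1 := ((lt_div_iff₀ hTp).1 hl0).le
    have hmono : ∀ z : ℝ, z ≤ T → lam * z ≤ 1 := fun z hz =>
      (mul_le_mul_of_nonneg_left hz hl.le).trans hlT
    exact equivariance_pos hl h0 (hmono _ (by linarith)) (hmono _ (by linarith)) hv hV hM
      (hmono _ (by linarith)) hK (hmono _ (by linarith)) hIc hreg l hle p hp hp'
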